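/- arXiv:0911.3570 — 5 statements merged into one kernel-verified Lean document; each statement's English description precedes it below -/
import Mathlib

section
/- Every four-dimensional power-commutative real division algebra contains an omnipresent idempotent, i.e. a nonzero idempotent e such that e belongs to every two-dimensional subalgebra. -/
open Module

section Defs

variable {A : Type*} [AddCommGroup A] [Module ℝ A]

/-- A linear subspace closed under the multiplication `m`. -/
def IsSubalg (m : A →ₗ[ℝ] A →ₗ[ℝ] A) (U : Submodule ℝ A) : Prop :=
  ∀ x ∈ U, ∀ y ∈ U, m x y ∈ U

/-- The subalgebra generated by a set `s`: the smallest subspace containing `s`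
and closed under multiplication. -/
def genSubalg (m : A →ₗ[ℝ] A →ₗ[ℝ] A) (s : Set A) : Submodule ℝ A :=
  sInf {U : Submodule ℝ A | IsSubalg m U ∧ s ⊆ (U : Set A)}

/-- `m` is a division-algebra multiplication: for nonzero `a`, both left and
right multiplication by `a` are bijective. -/
def IsDivision (m : A →ₗ[ℝ] A →ₗ[ℝ] A) : Prop :=
  ∀ a : A, a ≠ 0 →
    Function.Bijective (fun x : A => m a x) ∧ Function.Bijective (fun x : A => m x a)

/-- Power-commutativity: every subalgebra generated by a single element is commutative. -/
def PowerComm (m : A →ₗ[ℝ] A →ₗ[ℝ] A) : Prop :=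
  ∀ x : A, ∀ a ∈ genSubalg m {x}, ∀ b ∈ genSubalg m {x}, m a b = m b a

/-- An omnipresent idempotent: a nonzero idempotent contained in every
two-dimensional subalgebra. -/
def Omnipresent (m : A →ₗ[ℝ] A →ₗ[ℝ] A) (e : A) : Prop :=
  e ≠ 0 ∧ m e e = e ∧
    ∀ U : Submodule ℝ A, IsSubalg m U → Module.finrank ℝ U = 2 → e ∈ U

/-- `one` is an identity element for `m` and for every `x` the elements
`one, x, x²` are linearly dependent. -/
def IsQuadraticWith (m : A →ₗ[ℝ] A →ₗ[ℝ] A) (one : A) : Prop :=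
  (∀ x : A, m one x = x ∧ m x one = x) ∧
    ∀ x : A, ¬ LinearIndependent ℝ ![one, x, m x x]

/-- A quadratic algebra: unital, and `1, x, x²` linearly dependent for all `x`. -/
def IsQuadratic (m : A →ₗ[ℝ] A →ₗ[ℝ] A) : Prop :=
  ∃ one : A, IsQuadraticWith m one

/-- The isotope multiplication `x ∘ y = (T x)·(T y)`. -/
def isotope (m : A →ₗ[ℝ] A →ₗ[ℝ] A) (T : A →ₗ[ℝ] A) : A →ₗ[ℝ] A →ₗ[ℝ] A :=
  (m.compl₂ T).comp T

/-- A planar map on a quadratic division algebra with identity `one`: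
invertible, fixes `one`, and leaves every subalgebra invariant. -/
def Planar (m : A →ₗ[ℝ] A →ₗ[ℝ] A) (one : A) (T : A →ₗ[ℝ] A) : Prop :=
  Function.Bijective T ∧ T one = one ∧
    ∀ U : Submodule ℝ A, IsSubalg m U → ∀ x ∈ U, T x ∈ U

/-- The imaginary space `Im B = {x ∉ ℝ·1 : x² ∈ ℝ·1} ∪ {0}` of a quadratic algebra. -/
def ImSet (m : A →ₗ[ℝ] A →ₗ[ℝ] A) (one : A) : Set A :=
  {x : A | x ∉ Submodule.span ℝ {one} ∧ m x x ∈ Submodule.span ℝ {one}} ∪ {0}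

/-- The centraliser `C(e) = {y : e·y = y·e}`, a linear subspace. -/
def centraliser (m : A →ₗ[ℝ] A →ₗ[ℝ] A) (e : A) : Submodule ℝ A :=
  LinearMap.ker (m e - m.flip e)

/-- An exceptional idempotent of a four-dimensional algebra: its centraliser is
three-dimensional and closed under squaring. -/
def Exceptional (m : A →ₗ[ℝ] A →ₗ[ℝ] A) (e : A) : Prop :=
  Module.finrank ℝ (centraliser m e) = 3 ∧
    ∀ x ∈ centraliser m e, m x x ∈ centraliser m e

end Defs

section Hopf

variable {E : Type*} [NormedAddCommGroup E] [NormedSpace ℝ E]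

theorem exists_zero_of_antiperiodic {g : ℝ → ℝ} (hg : Continuous g)
    (h : g Real.pi = -g 0) : ∃ θ, g θ = 0 := by
  rcases le_total (g 0) 0 with h0 | h0
  · obtain ⟨θ, -, h⟩ := intermediate_value_Icc Real.pi_pos.le hg.continuousOn
      (show (0 : ℝ) ∈ Set.Icc (g 0) (g Real.pi) from ⟨h0, by linarith⟩)
    exact ⟨θ, h⟩
  · obtain ⟨θ, -, h⟩ := intermediate_value_Icc' Real.pi_pos.le hg.continuousOn
      (show (0 : ℝ) ∈ Set.Icc (g Real.pi) (g 0) from ⟨by linarith, h0⟩)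
    exact ⟨θ, h⟩

theorem eq_zero_of_eq_neg {V : Type*} [AddCommGroup V] [Module ℝ V] {x : V} (h : x = -x) :
    x = 0 := by
  have : (2 : ℝ) • x = 0 := by rw [two_smul, ← eq_neg_iff_add_eq_zero, ← h]
  simpa using this

theorem eq_or_eq_neg_of_sq_eq (B : E →L[ℝ] E →L[ℝ] E) (hcomm : ∀ x y, B x y = B y x)
    (h : ∀ x y, B x y = 0 → x = 0 ∨ y = 0) {x y : E} (hxy : B x x = B y y) : x = y ∨ x = -y := by
  have : B (x - y) (x + y) = 0 := by
    simp only [map_sub, map_add, sub_apply, hxy, hcomm x y]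
    abel
  exact (h _ _ this).imp sub_eq_zero.1 eq_neg_of_add_eq_zero_left

variable [FiniteDimensional ℝ E]

theorem exists_pos_mul_norm_sq_le (B : E →L[ℝ] E →L[ℝ] E) (h : ∀ x, B x x = 0 → x = 0) :
    ∃ c > 0, ∀ x, c * ‖x‖ ^ 2 ≤ ‖B x x‖ := by
  rcases subsingleton_or_nontrivial E with hE | hE
  · exact ⟨1, one_pos, fun x => by simp [Subsingleton.elim x 0]⟩
  obtain ⟨x₀, hx₀, hmin⟩ := (isCompact_sphere (0 : E) 1).exists_isMinOn
    (NormedSpace.sphere_nonempty.2 zero_le_one) (f := fun x => ‖B x x‖) (by fun_prop)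
  have hx₀' : x₀ ≠ 0 := by
    rintro rfl
    simp at hx₀
  refine ⟨‖B x₀ x₀‖, norm_pos_iff.2 fun h0 => hx₀' (h _ h0), fun x => ?_⟩
  rcases eq_or_ne x 0 with rfl | hx
  · simp
  have hn : ‖x‖ ≠ 0 := norm_ne_zero_iff.2 hx
  have := hmin (a := ‖x‖⁻¹ • x) (by simp [norm_smul, hn])
  simp only [map_smul, smul_apply, norm_smul, norm_inv, norm_norm,
    Set.mem_ofPred_eq] at this
  calc ‖B x₀ x₀‖ * ‖x‖ ^ 2 ≤ ‖x‖⁻¹ * (‖x‖⁻¹ * ‖B x x‖) * ‖x‖ ^ 2 := by gcongr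
    _ = ‖B x x‖ := by field_simp

theorem isClosedMap_sq (B : E →L[ℝ] E →L[ℝ] E) (h : ∀ x, B x x = 0 → x = 0) :
    IsClosedMap fun x => B x x := by
  obtain ⟨c, hc, hB⟩ := exists_pos_mul_norm_sq_le B h
  refine (isProperMap_iff_tendsto_cocompact.2 ⟨by fun_prop, ?_⟩).isClosedMap
  rw [← Metric.cobounded_eq_cocompact, ← tendsto_norm_atTop_iff_cobounded]
  refine Filter.tendsto_atTop_mono hB ?_
  exact ((Filter.tendsto_pow_atTop two_ne_zero).comp
    tendsto_norm_cobounded_atTop).const_mul_atTop hc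

theorem isCoveringMapOn_sq (B : E →L[ℝ] E →L[ℝ] E) (hcomm : ∀ x y, B x y = B y x)
    (h : ∀ x y, B x y = 0 → x = 0 ∨ y = 0) :
    IsCoveringMapOn (fun x => B x x) {0}ᶜ := by
  refine (isClosedMap_sq B fun x hx => by
    simpa using h x x hx).isCoveringMapOn_of_isLocalHomeomorphOn (fun x _ => ?_) fun x hx => ?_
  · by_cases hx : ∃ y, B y y = x
    · obtain ⟨y, rfl⟩ := hx
      refine Set.Finite.subset (Set.toFinite {y, -y}) fun z hz => ?_
      have hz : B z z = B y y := hz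
      exact eq_or_eq_neg_of_sq_eq B hcomm h hz
    · convert! Set.finite_empty
      ext y
      simpa using fun hy => hx ⟨y, hy⟩
  · have hx : x ≠ 0 := by
      rintro rfl
      simp at hx
    have hinj : Function.Injective ((2 : ℝ) • B x : E →L[ℝ] E) := by
      rw [injective_iff_map_eq_zero]
      intro y hy
      simpa [hx] using h x y (by simpa using hy)
    let L : E ≃L[ℝ] E :=
      (LinearEquiv.ofInjectiveEndo ((2 : ℝ) • B x : E →L[ℝ] E).toLinearMap
        hinj).toContinuousLinearEquiv
    have hd : HasStrictFDerivAt (fun x => B x x) (L : E →L[ℝ] E) x := by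
      have := B.isBoundedBilinearMap.hasStrictFDerivAt (x, x)
      have := HasStrictFDerivAt.comp (g := fun p : E × E => B p.1 p.2) (f := fun y : E => (y, y))
        x this ((hasStrictFDerivAt_id x).prodMk (hasStrictFDerivAt_id x))
      refine this.congr_fderiv ?_
      ext y
      simp [L, hcomm y x, two_smul]
    exact ⟨hd.toOpenPartialHomeomorph _, hd.mem_toOpenPartialHomeomorph_source, rfl⟩

theorem finrank_lt_four_of_comm (B : E →L[ℝ] E →L[ℝ] E) (hcomm : ∀ x y, B x y = B y x)
    (h : ∀ x y, B x y = 0 → x = 0 ∨ y = 0) : finrank ℝ E < 4 := by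
  by_contra! hE
  obtain ⟨x, y, hxy⟩ : ∃ x y : E, LinearIndependent ℝ ![x, y] := by
    have hn : Nontrivial E := Module.nontrivial_of_finrank_pos (R := ℝ) (by omega)
    obtain ⟨x, hx⟩ := exists_ne (0 : E)
    obtain ⟨y, hy⟩ := exists_linearIndependent_pair_of_one_lt_finrank (R := ℝ) (by omega) hx
    exact ⟨x, y, hy⟩
  rw [LinearIndependent.pair_iff] at hxy
  obtain ⟨v, hv⟩ : ∃ v, v ∉ Submodule.span ℝ (Set.range ![B x x, B y y, B x y]) := by
    by_contra! hW
    have h1 := finrank_range_le_card (R := ℝ) ![B x x, B y y, B x y]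
    rw [Set.finrank, (Submodule.eq_top_iff'.2 hW), finrank_top] at h1
    simp at h1
    omega
  let f : ℝ × ℝ → E := fun p => ((1 + p.1) / 2) • B x x + ((1 - p.1) / 2) • B y y + p.2 • B x y
    + (1 - p.1 ^ 2 - p.2 ^ 2) • v
  let k : ℝ → E := fun θ => Real.cos θ • x + Real.sin θ • y
  have hfk : ∀ θ, f (Real.cos (2 * θ), Real.sin (2 * θ)) = B (k θ) (k θ) := by
    intro θ
    have h1 : (1 + Real.cos (2 * θ)) / 2 = Real.cos θ * Real.cos θ := by
      rw [Real.cos_two_mul]; ring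
    have h2 : (1 - Real.cos (2 * θ)) / 2 = Real.sin θ * Real.sin θ := by
      rw [Real.cos_two_mul', Real.cos_sq']; ring
    have h3 : 1 - Real.cos (2 * θ) ^ 2 - Real.sin (2 * θ) ^ 2 = 0 := by
      linarith [Real.cos_sq_add_sin_sq (2 * θ)]
    simp only [f, h3]
    simp only [k, h1, h2, Real.sin_two_mul, map_add, map_smul, add_apply, smul_apply, hcomm y x]
    module
  have hk : ∀ θ, k θ ≠ 0 := by
    intro θ hθ
    obtain ⟨h1, h2⟩ := hxy _ _ hθ
    have := Real.cos_sq_add_sin_sq θ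
    simp [h1, h2] at this
  have hf : ∀ p, f p ∈ ({0}ᶜ : Set E) := by
    rintro ⟨c, s⟩ h0
    have h0 : f (c, s) = 0 := h0
    by_cases hcs : 1 - c ^ 2 - s ^ 2 = 0
    · have hz : ‖(⟨c, s⟩ : ℂ)‖ = 1 := by
        rw [Complex.norm_def, Complex.normSq_mk, Real.sqrt_eq_one]
        linarith
      have hc := Complex.norm_mul_cos_arg ⟨c, s⟩
      have hs := Complex.norm_mul_sin_arg ⟨c, s⟩
      rw [hz, one_mul] at hc hs
      have h1 := hfk (Complex.arg ⟨c, s⟩ / 2)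
      rw [mul_div_cancel₀ _ (two_ne_zero), hc, hs, h0] at h1
      exact hk _ (by simpa using h _ _ h1.symm)
    · apply hv
      have : v = (-(1 - c ^ 2 - s ^ 2)⁻¹) •
          (((1 + c) / 2) • B x x + ((1 - c) / 2) • B y y + s • B x y) := by
        rw [neg_smul, eq_neg_iff_add_eq_zero, ← smul_eq_zero_iff_right hcs, smul_add,
          smul_inv_smul₀ hcs, ← h0, add_comm]
      rw [this]
      refine Submodule.smul_mem _ _ (add_mem (add_mem ?_ ?_) ?_) <;>
        refine Submodule.smul_mem _ _ (Submodule.subset_span ?_) <;> simp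
  obtain ⟨F, ⟨hF0, hF⟩, -⟩ := (isCoveringMapOn_sq B hcomm h).existsUnique_continuousMap_lifts
    (⟨f, by fun_prop⟩ : C(ℝ × ℝ, E)) (a₀ := (1, 0)) (e₀ := x) (by simp [f]) hf
  have hF : ∀ p, B (F p) (F p) = f p := fun p => congr_fun hF p
  let g : ℝ → E := fun θ => F (Real.cos (2 * θ), Real.sin (2 * θ))
  have hgc : Continuous g := by fun_prop
  have hkc : Continuous k := by fun_prop
  have hgk : ∀ θ, g θ = k θ ∨ g θ = - k θ := by
    intro θ
    have h1 : B (g θ) (g θ) = B (k θ) (k θ) := (hF _).trans (hfk θ)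
    exact eq_or_eq_neg_of_sq_eq B hcomm h h1
  have hclopen : IsClopen {θ | g θ = k θ} := by
    refine ⟨isClosed_eq hgc hkc, ?_⟩
    have : {θ | g θ = k θ}ᶜ = {θ | g θ = -k θ} := by
      ext θ
      refine ⟨fun h1 => (hgk θ).resolve_left h1, fun h1 (h2 : g θ = k θ) => hk θ ?_⟩
      exact eq_zero_of_eq_neg (h2.symm.trans h1)
    rw [← isClosed_compl_iff, this]
    exact isClosed_eq hgc hkc.neg
  have huniv := hclopen.eq_univ ⟨0, by simp [g, k, hF0]⟩
  have hpi : g Real.pi = k Real.pi := by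
    change Real.pi ∈ {θ | g θ = k θ}
    rw [huniv]
    trivial
  have : x = -x := by simpa [g, k, hF0] using hpi
  exact hk 0 (by simpa [k] using eq_zero_of_eq_neg this)

end Hopf

section Reduction

variable {A : Type*} [AddCommGroup A] [Module ℝ A] {m : A →ₗ[ℝ] A →ₗ[ℝ] A}

theorem finrank_span_pair {x y : A} (h : LinearIndependent ℝ ![x, y]) :
    finrank ℝ (Submodule.span ℝ {x, y}) = 2 := by
  have := finrank_span_eq_card h
  rwa [Matrix.range_cons_cons_empty, Fintype.card_fin] at this

theorem exists_not_comm [FiniteDimensional ℝ A] (hdim : 4 ≤ finrank ℝ A)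
    (hz : ∀ x y, m x y = 0 → x = 0 ∨ y = 0) : ∃ x y, m x y ≠ m y x := by
  by_contra! hc
  let φ : A ≃ₗ[ℝ] (Fin (finrank ℝ A) → ℝ) := (finBasis ℝ A).equivFun
  let f := (m.compr₂ φ.toLinearMap).compl₁₂ φ.symm.toLinearMap φ.symm.toLinearMap
  have h := finrank_lt_four_of_comm f.toContinuousBilinearMap
    (fun x y => congrArg φ (hc (φ.symm x) (φ.symm y))) (fun x y hxy => by
      have : φ (m (φ.symm x) (φ.symm y)) = 0 := hxy
      simpa using hz (φ.symm x) (φ.symm y) (by simpa using this))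
  rw [finrank_fin_fun] at h
  omega

theorem finrank_ne_three [FiniteDimensional ℝ A] (hz : ∀ x y, m x y = 0 → x = 0 ∨ y = 0)
    {S : Submodule ℝ A} (hS : IsSubalg m S) : finrank ℝ S ≠ 3 := by
  intro h3
  have hn : Nontrivial S := Module.nontrivial_of_finrank_pos (R := ℝ) (by omega)
  obtain ⟨a, ha⟩ := exists_ne (0 : S)
  obtain ⟨b, hab⟩ := exists_linearIndependent_pair_of_one_lt_finrank (R := ℝ) (by omega) ha
  rw [LinearIndependent.pair_iff] at hab
  let L : S → S →ₗ[ℝ] S := fun x => (m x).restrict fun y hy => hS x x.2 y hy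
  let v := finBasisOfFinrankEq ℝ S h3
  let M : S → Matrix (Fin 3) (Fin 3) ℝ := fun x => LinearMap.toMatrix v v (L x)
  let D : ℝ → ℝ := fun θ => (Real.cos θ • M a + Real.sin θ • M b).det
  obtain ⟨θ, hθ⟩ := exists_zero_of_antiperiodic (g := D) (by fun_prop) (by
    simp [D, Matrix.det_neg, pow_succ])
  have hL : LinearMap.det (L (Real.cos θ • a + Real.sin θ • b)) = 0 := by
    rw [← LinearMap.det_toMatrix v, ← hθ]
    simp only [D, M, ← map_smul, ← map_add]
    congr 2
    ext x
    simp [L]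
  obtain ⟨y, hy, hy0⟩ := Submodule.exists_mem_ne_zero_of_ne_bot
    (LinearMap.bot_lt_ker_of_det_eq_zero hL).ne'
  have : m ((Real.cos θ • a + Real.sin θ • b : S) : A) y = 0 := by
    simpa [L] using congrArg Subtype.val (LinearMap.mem_ker.1 hy)
  rcases hz _ _ this with h | h
  · obtain ⟨h1, h2⟩ := hab _ _ (Subtype.ext h)
    have := Real.cos_sq_add_sin_sq θ
    simp [h1, h2] at this
  · exact hy0 (Subtype.ext h)

theorem finrank_genSubalg_le_two (hdim : finrank ℝ A = 4)
    (hz : ∀ x y, m x y = 0 → x = 0 ∨ y = 0) (hpc : PowerComm m) (x : A) :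
    finrank ℝ (genSubalg m {x}) ≤ 2 := by
  have hfd : FiniteDimensional ℝ A := .of_finrank_pos (by omega)
  have hG : IsSubalg m (genSubalg m {x}) := fun a ha b hb => by
    simp only [genSubalg, Submodule.mem_sInf] at *
    exact fun U hU => hU.1 a (ha U hU) b (hb U hU)
  have h3 := finrank_ne_three hz hG
  have h4 : finrank ℝ (genSubalg m {x}) ≠ 4 := by
    intro h4
    have htop := Submodule.eq_top_of_finrank_eq (h4.trans hdim.symm)
    obtain ⟨a, b, hab⟩ := exists_not_comm hdim.ge hz
    exact hab (hpc x a (htop ▸ trivial) b (htop ▸ trivial))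
  have := Submodule.finrank_le (genSubalg m {x})
  omega

theorem mem_genSubalg_self (x : A) : x ∈ genSubalg m {x} := by
  simp only [genSubalg, Submodule.mem_sInf]
  exact fun U hU => hU.2 rfl

theorem sq_mem_genSubalg (x : A) : m x x ∈ genSubalg m {x} := by
  simp only [genSubalg, Submodule.mem_sInf]
  exact fun U hU => hU.1 _ (hU.2 rfl) _ (hU.2 rfl)

theorem isSubalg_span_sq (hdim : finrank ℝ A = 4)
    (hz : ∀ x y, m x y = 0 → x = 0 ∨ y = 0) (hpc : PowerComm m) (x : A) :
    IsSubalg m (Submodule.span ℝ {x, m x x}) := by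
  have hfd : FiniteDimensional ℝ A := .of_finrank_pos (by omega)
  by_cases hx : LinearIndependent ℝ ![x, m x x]
  · have hle : Submodule.span ℝ {x, m x x} ≤ genSubalg m {x} := by
      rw [Submodule.span_le, Set.pair_subset_iff]
      exact ⟨mem_genSubalg_self x, sq_mem_genSubalg x⟩
    have hr := finrank_span_pair hx
    rw [Submodule.eq_of_le_of_finrank_le hle (hr ▸ finrank_genSubalg_le_two hdim hz hpc x)]
    intro a ha b hb
    simp only [genSubalg, Submodule.mem_sInf] at *
    exact fun U hU => hU.1 a (ha U hU) b (hb U hU)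
  · rcases eq_or_ne x 0 with rfl | hx0
    · intro a ha b hb
      have : a = 0 := by simpa using ha
      simp [this]
    · rw [LinearIndependent.pair_iff' hx0] at hx
      push Not at hx
      obtain ⟨c, hc⟩ := hx
      have hs : Submodule.span ℝ {x, m x x} = Submodule.span ℝ {x} := by
        refine le_antisymm (Submodule.span_le.2 ?_) (Submodule.span_mono (by simp))
        rw [Set.pair_subset_iff, ← hc]
        exact ⟨Submodule.mem_span_singleton_self x,
          Submodule.smul_mem _ _ (Submodule.mem_span_singleton_self x)⟩
      rw [hs]
      intro a ha b hb
      obtain ⟨r, rfl⟩ := Submodule.mem_span_singleton.1 ha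
      obtain ⟨s, rfl⟩ := Submodule.mem_span_singleton.1 hb
      simp only [map_smul, LinearMap.smul_apply, ← hc]
      exact Submodule.smul_mem _ _ (Submodule.smul_mem _ _ (Submodule.smul_mem _ _
        (Submodule.mem_span_singleton_self x)))

theorem mul_sq_comm (hpc : PowerComm m) (x : A) : m x (m x x) = m (m x x) x :=
  hpc x _ (mem_genSubalg_self x) _ (sq_mem_genSubalg x)

end Reduction

section Planes

variable {A : Type*} [AddCommGroup A] [Module ℝ A] {m : A →ₗ[ℝ] A →ₗ[ℝ] A}

/-- A two-dimensional subalgebra. -/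
def IsPlane (m : A →ₗ[ℝ] A →ₗ[ℝ] A) (U : Submodule ℝ A) : Prop :=
  IsSubalg m U ∧ finrank ℝ U = 2

/-- A nonzero idempotent. -/
def IsIdem (m : A →ₗ[ℝ] A →ₗ[ℝ] A) (e : A) : Prop :=
  e ≠ 0 ∧ m e e = e

/-- The consequences of power-commutativity used below: in a four-dimensional power-commutative
division algebra `x` and `x²` span a commutative subalgebra, and the algebra is not commutative. -/
structure PlanarPowers (m : A →ₗ[ℝ] A →ₗ[ℝ] A) : Prop where
  finrank_eq : finrank ℝ A = 4
  eq_zero_or : ∀ {x y : A}, m x y = 0 → x = 0 ∨ y = 0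
  isSubalg : ∀ x, IsSubalg m (Submodule.span ℝ {x, m x x})
  sq_comm : ∀ x, m x (m x x) = m (m x x) x
  not_comm : ∃ x y, m x y ≠ m y x

namespace PlanarPowers

theorem of_powerComm (hdim : finrank ℝ A = 4) (hdiv : IsDivision m) (hpc : PowerComm m) :
    PlanarPowers m := by
  have hfd : FiniteDimensional ℝ A := .of_finrank_pos (by omega)
  have hz : ∀ x y, m x y = 0 → x = 0 ∨ y = 0 := fun x y h => by
    by_contra! hxy
    exact hxy.2 ((hdiv x hxy.1).1.1 (by simpa using h))
  exact ⟨hdim, fun h => hz _ _ h, isSubalg_span_sq hdim hz hpc, mul_sq_comm hpc,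
    exists_not_comm hdim.ge hz⟩

end PlanarPowers

theorem span_pair_eq {U : Submodule ℝ A} (hU : finrank ℝ U ≤ 2) [FiniteDimensional ℝ U] {x y : A}
    (hx : x ∈ U) (hy : y ∈ U) (h : LinearIndependent ℝ ![x, y]) :
    Submodule.span ℝ {x, y} = U :=
  Submodule.eq_of_le_of_finrank_le (Submodule.span_le.2 (Set.pair_subset hx hy))
    (by rwa [finrank_span_pair h])

theorem exists_linearIndependent_pair_mem {U : Submodule ℝ A} (hU : 2 ≤ finrank ℝ U) :
    ∃ x ∈ U, ∃ y ∈ U, LinearIndependent ℝ ![x, y] := by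
  have hn : Nontrivial U := Module.nontrivial_of_finrank_pos (R := ℝ) (by omega)
  obtain ⟨x, hx⟩ := exists_ne (0 : U)
  obtain ⟨y, hy⟩ := exists_linearIndependent_pair_of_one_lt_finrank (R := ℝ) (by omega) hx
  refine ⟨x, x.2, y, y.2, ?_⟩
  rw [LinearIndependent.pair_iff] at hy ⊢
  exact fun s t hst => hy s t (Subtype.ext hst)

theorem IsIdem.linearIndependent {a b : A} (ha : IsIdem m a) (hb : IsIdem m b) (hab : a ≠ b) :
    LinearIndependent ℝ ![a, b] := by
  rw [LinearIndependent.pair_iff' ha.1]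
  rintro c rfl
  have h := hb.2
  simp only [map_smul, LinearMap.smul_apply, ha.2] at h
  have hc := hb.1
  have hc0 : c ≠ 0 := by
    rintro rfl
    simp at hc
  have : c • a = a := smul_right_injective _ hc0 h
  exact hab this.symm

theorem exists_isIdem_smul (hz : ∀ {x y : A}, m x y = 0 → x = 0 ∨ y = 0) {x : A} (hx : x ≠ 0)
    (h : ¬LinearIndependent ℝ ![x, m x x]) : ∃ c : ℝ, c ≠ 0 ∧ IsIdem m (c • x) := by
  rw [LinearIndependent.pair_iff' hx] at h
  push Not at h
  obtain ⟨c, hc⟩ := h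
  have hc0 : c ≠ 0 := by
    rintro rfl
    rw [zero_smul] at hc
    simpa [hx] using hz hc.symm
  refine ⟨c⁻¹, inv_ne_zero hc0, smul_ne_zero (inv_ne_zero hc0) hx, ?_⟩
  rw [map_smul, map_smul, LinearMap.smul_apply, ← hc, inv_smul_smul₀ hc0]

theorem IsIdem.mul_add_mul_ne (hz : ∀ {x y : A}, m x y = 0 → x = 0 ∨ y = 0) {a b : A}
    (ha : IsIdem m a) (hb : IsIdem m b) (hab : a ≠ b) : m a b + m b a ≠ a + b := by
  intro h
  have : m (a - b) (a - b) = 0 := by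
    have h1 : m (a - b) (a - b) = m a a + m b b - (m a b + m b a) := by
      simp only [map_sub, LinearMap.sub_apply]
      abel
    rw [h1, h, ha.2, hb.2, sub_self]
  exact hab (sub_eq_zero.1 (by simpa using hz this))

theorem exists_linearIndependent_sq (hz : ∀ {x y : A}, m x y = 0 → x = 0 ∨ y = 0)
    {V : Submodule ℝ A} (hV : 2 ≤ finrank ℝ V) :
    ∃ x ∈ V, LinearIndependent ℝ ![x, m x x] := by
  by_contra! hn
  obtain ⟨a, ha, b, hb, hab⟩ := exists_linearIndependent_pair_mem hV
  obtain ⟨c, hc, hca⟩ := exists_isIdem_smul hz (hab.ne_zero 0) (hn a ha)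
  obtain ⟨d, hd, hdb⟩ := exists_isIdem_smul hz (hab.ne_zero 1) (hn b hb)
  simp only [Matrix.cons_val_zero, Matrix.cons_val_one] at hca hdb
  have hca' := V.smul_mem c ha
  have hdb' := V.smul_mem d hb
  have hli : LinearIndependent ℝ ![c • a, d • b] := by
    rw [LinearIndependent.pair_iff] at hab ⊢
    intro s t hst
    rw [smul_smul, smul_smul] at hst
    simpa [hc, hd] using hab _ _ hst
  generalize c • a = a, d • b = b at *
  rw [LinearIndependent.pair_iff] at hli
  have h1 := hn _ (V.add_mem hca' hdb')
  have h2 := hn _ (V.add_mem hca' (V.smul_mem (2 : ℝ) hdb'))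
  have hne : a + b ≠ 0 := fun h => by simpa using hli 1 1 (by simpa using h)
  have hne2 : a + (2 : ℝ) • b ≠ 0 := fun h => by simpa using hli 1 2 (by simpa using h)
  rw [LinearIndependent.pair_iff' hne] at h1
  rw [LinearIndependent.pair_iff' hne2] at h2
  push Not at h1 h2
  obtain ⟨r, hr⟩ := h1
  obtain ⟨s, hs⟩ := h2
  simp only [map_add, map_smul, LinearMap.add_apply, LinearMap.smul_apply, hca.2, hdb.2] at hr hs
  have hk : m a b + m b a = (r - 1) • (a + b) := by
    linear_combination (norm := module) -hr
  obtain ⟨h3, h4⟩ := hli (1 + 2 * (r - 1) - s) (4 + 2 * (r - 1) - 2 * s) (by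
    linear_combination (norm := module) -(2 : ℝ) • hk - hs)
  have hr2 : r - 1 = 1 := by linarith
  rw [hr2, one_smul] at hk
  refine hca.mul_add_mul_ne hz hdb ?_ hk
  rintro rfl
  simpa using hli 1 (-1) (by simp)

theorem finite_isIdem (hz : ∀ {x y : A}, m x y = 0 → x = 0 ∨ y = 0)
    {V : Submodule ℝ A} [FiniteDimensional ℝ V] (hV : finrank ℝ V ≤ 2) :
    {e | IsIdem m e ∧ e ∈ V}.Finite := by
  rcases Set.subsingleton_or_nontrivial {e | IsIdem m e ∧ e ∈ V} with h | h
  · exact h.finite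
  obtain ⟨a, ⟨ha, haV⟩, b, ⟨hb, hbV⟩, hab⟩ := h
  have hli := ha.linearIndependent hb hab
  have hspan := span_pair_eq hV haV hbV hli
  rw [LinearIndependent.pair_iff] at hli
  have key : ∀ e, IsIdem m e → e ∈ V → e ≠ a → e ≠ b → ∃ x y : ℝ, x • a + y • b = e ∧
      x ≠ 0 ∧ y ≠ 0 ∧ (x * y) • (m a b + m b a) = (x - x * x) • a + (y - y * y) • b := by
    intro e he heV hea heb
    rw [← hspan, Submodule.mem_span_pair] at heV
    obtain ⟨x, y, rfl⟩ := heV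
    have h := he.2
    simp only [map_add, map_smul, LinearMap.add_apply, LinearMap.smul_apply, ha.2, hb.2] at h
    have h0 := he.1
    refine ⟨x, y, rfl, ?_, ?_, ?_⟩
    · rintro rfl
      have h1 := (hli 0 (y * y - y) (by linear_combination (norm := module) h)).2
      have hy : y ≠ 0 := by
        rintro rfl
        simp at h0
      have hy1 : y = 1 := mul_left_cancel₀ hy (by linarith)
      simp [hy1] at heb
    · rintro rfl
      have h1 := (hli (x * x - x) 0 (by linear_combination (norm := module) h)).1
      have hx : x ≠ 0 := by
        rintro rfl
        simp at h0
      have hx1 : x = 1 := mul_left_cancel₀ hx (by linarith)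
      simp [hx1] at hea
    · linear_combination (norm := module) h
  have huniq : {e | (IsIdem m e ∧ e ∈ V) ∧ e ≠ a ∧ e ≠ b}.Subsingleton := by
    rintro e ⟨⟨he, heV⟩, hea, heb⟩ f ⟨⟨hf, hfV⟩, hfa, hfb⟩
    obtain ⟨x, y, rfl, hx, hy, hk⟩ := key e he heV hea heb
    obtain ⟨z, w, rfl, hZ, hw, hk'⟩ := key f hf hfV hfa hfb
    obtain ⟨h1, h2⟩ := hli (z * w * (x - x * x) - x * y * (z - z * z))
      (z * w * (y - y * y) - x * y * (w - w * w)) (by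
        linear_combination (norm := module) (x * y) • hk' - (z * w) • hk)
    have h3 : w * (1 - x) = y * (1 - z) :=
      mul_left_cancel₀ (mul_ne_zero hx hZ) (by linarith)
    have h4 : z * (1 - y) = x * (1 - w) :=
      mul_left_cancel₀ (mul_ne_zero hy hw) (by linarith)
    have h5 : (x + y - 1) * (z - x) = 0 := by linear_combination h3 - (1 - x) * (h3 + h4)
    rcases mul_eq_zero.1 h5 with h5 | h5
    · refine absurd ?_ (ha.mul_add_mul_ne hz hb hab)
      rw [show x - x * x = x * y by linear_combination -x * h5,
        show y - y * y = x * y by linear_combination -y * h5, ← smul_add] at hk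
      exact smul_right_injective _ (mul_ne_zero hx hy) hk
    · obtain rfl : z = x := sub_eq_zero.1 h5
      obtain rfl : w = y := by linear_combination h3 + h4
      rfl
  refine ((huniq.finite.insert b).insert a).subset fun e he => ?_
  by_cases h1 : e = a
  · exact .inl h1
  by_cases h2 : e = b
  · exact .inr (.inl h2)
  exact .inr (.inr ⟨he, h1, h2⟩)

end Planes

section Generic

variable {A : Type*} [AddCommGroup A] [Module ℝ A]

/-- Every line through a point of `S` meets `S` in a cofinite subset of the line. -/
def LineCofinite (S : Set A) : Prop :=
  ∀ x y, x ∈ S → {t : ℝ | x + t • y ∉ S}.Finite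

theorem LineCofinite.biInter {ι : Type*} {s : Set ι} (hs : s.Finite) {S : ι → Set A}
    (hS : ∀ i ∈ s, LineCofinite (S i)) : LineCofinite (⋂ i ∈ s, S i) := fun x y hx => by
  refine (hs.biUnion fun i hi => hS i hi x y (Set.mem_iInter₂.1 hx i hi)).subset fun t ht => ?_
  simpa using ht

theorem LineCofinite.exists_mem_inter {S T : Set A} (hS : LineCofinite S) (hT : LineCofinite T)
    {P : Submodule ℝ A} (h1 : ∃ x ∈ P, x ∈ S) (h2 : ∃ x ∈ P, x ∈ T) :
    ∃ x ∈ P, x ∈ S ∩ T := by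
  obtain ⟨x, hxP, hx⟩ := h1
  obtain ⟨y, hyP, hy⟩ := h2
  have hf := (hS x (y - x) hx).union
    ((hT y (x - y) hy).preimage (f := fun t : ℝ => 1 - t) sub_right_injective.injOn)
  obtain ⟨t, ht⟩ := hf.infinite_compl.nonempty
  simp only [Set.mem_compl_iff, Set.mem_union, Set.mem_preimage, Set.mem_ofPred_eq, not_or,
    not_not] at ht
  refine ⟨x + t • (y - x), P.add_mem hxP (P.smul_mem _ (P.sub_mem hyP hxP)), ht.1, ?_⟩
  convert! ht.2 using 1
  module

theorem LineCofinite.exists_mem_biInter {ι : Type*} {s : Set ι} (hs : s.Finite) {S : ι → Set A}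
    (hS : ∀ i ∈ s, LineCofinite (S i)) {P : Submodule ℝ A} (h : ∀ i ∈ s, ∃ x ∈ P, x ∈ S i) :
    ∃ x ∈ P, ∀ i ∈ s, x ∈ S i := by
  induction s, hs using Set.Finite.induction_on with
  | empty => exact ⟨0, P.zero_mem, by simp⟩
  | @insert a s ha hs ih =>
    simp only [Set.forall_mem_insert] at *
    obtain ⟨x, hx, hxs⟩ := ih hS.2 h.2
    obtain ⟨y, hy, hy1, hy2⟩ := hS.1.exists_mem_inter (LineCofinite.biInter hs hS.2) h.1
      ⟨x, hx, Set.mem_iInter₂.2 hxs⟩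
    exact ⟨y, hy, hy1, Set.mem_iInter₂.1 hy2⟩

theorem lineCofinite_of_polynomial {S : Set A}
    (h : ∀ x y, x ∈ S → ∃ p : Polynomial ℝ, p.eval 0 ≠ 0 ∧ ∀ t, p.eval t ≠ 0 → x + t • y ∈ S) :
    LineCofinite S := fun x y hx => by
  obtain ⟨p, hp0, hp⟩ := h x y hx
  have hne : p ≠ 0 := by
    rintro rfl
    simp at hp0
  refine (Polynomial.finite_setOfPred_isRoot hne).subset fun t ht => ?_
  by_contra h
  exact ht (hp t h)

theorem lineCofinite_compl (P : Submodule ℝ A) : LineCofinite (P : Set A)ᶜ := by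
  intro x y hx
  refine Set.Subsingleton.finite fun t ht s hs => ?_
  simp only [Set.mem_ofPred_eq, Set.mem_compl_iff, not_not, SetLike.mem_coe] at ht hs hx
  by_contra hts
  have hy : (t - s) • y ∈ P := by
    convert! P.sub_mem ht hs using 1
    module
  have hy' := (P.smul_mem_iff (sub_ne_zero.2 hts)).1 hy
  exact hx ((P.add_mem_iff_left (P.smul_mem t hy')).1 ht)

theorem exists_dual_pair {C : Type*} [AddCommGroup C] [Module ℝ C] {p q : C}
    (h : LinearIndependent ℝ ![p, q]) :
    ∃ φ ψ : C →ₗ[ℝ] ℝ, φ p = 1 ∧ φ q = 0 ∧ ψ p = 0 ∧ ψ q = 1 := by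
  have key : ∀ f : Fin 2 → ℝ, ∃ φ : C →ₗ[ℝ] ℝ, φ p = f 0 ∧ φ q = f 1 := by
    intro f
    obtain ⟨φ, hφ⟩ := LinearMap.exists_extend ((Basis.span h).constr ℝ f)
    refine ⟨φ, ?_, ?_⟩
    · have := LinearMap.congr_fun hφ (Basis.span h 0)
      rwa [Basis.constr_basis, LinearMap.comp_apply, Submodule.subtype_apply,
        Basis.span_apply] at this
    · have := LinearMap.congr_fun hφ (Basis.span h 1)
      rwa [Basis.constr_basis, LinearMap.comp_apply, Submodule.subtype_apply,
        Basis.span_apply] at this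
  obtain ⟨φ, hφ⟩ := key ![1, 0]
  obtain ⟨ψ, hψ⟩ := key ![0, 1]
  exact ⟨φ, ψ, hφ.1, hφ.2, hψ.1, hψ.2⟩

theorem lineCofinite_linearIndependent_sq {C : Type*} [AddCommGroup C] [Module ℝ C]
    (L : A →ₗ[ℝ] C) (B : A →ₗ[ℝ] A →ₗ[ℝ] C) :
    LineCofinite {x | LinearIndependent ℝ ![L x, B x x]} := by
  refine lineCofinite_of_polynomial fun x y hx => ?_
  obtain ⟨φ, ψ, h1, h2, h3, h4⟩ := exists_dual_pair hx
  let lin : (C →ₗ[ℝ] ℝ) → Polynomial ℝ := fun f =>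
    Polynomial.C (f (L x)) + Polynomial.C (f (L y)) * Polynomial.X
  let quad : (C →ₗ[ℝ] ℝ) → Polynomial ℝ := fun f => Polynomial.C (f (B x x))
    + Polynomial.C (f (B x y) + f (B y x)) * Polynomial.X
    + Polynomial.C (f (B y y)) * Polynomial.X ^ 2
  have hlin : ∀ f t, (lin f).eval t = f (L (x + t • y)) := by
    intro f t
    simp [lin]
    ring
  have hquad : ∀ f t, (quad f).eval t = f (B (x + t • y) (x + t • y)) := by
    intro f t
    simp [quad]
    ring
  refine ⟨lin φ * quad ψ - lin ψ * quad φ, ?_, fun t ht => ?_⟩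
  · simp [lin, quad, h1, h2, h3, h4]
  · simp only [Polynomial.eval_sub, Polynomial.eval_mul, hlin, hquad] at ht
    change LinearIndependent ℝ ![L (x + t • y), B (x + t • y) (x + t • y)]
    generalize L (x + t • y) = p, B (x + t • y) (x + t • y) = q at ht
    rw [LinearIndependent.pair_iff]
    intro a b hab
    have hφ : a * φ p + b * φ q = 0 := by simpa using congrArg φ hab
    have hψ : a * ψ p + b * ψ q = 0 := by simpa using congrArg ψ hab
    refine ⟨(mul_eq_zero.1 (?_ : a * _ = 0)).resolve_right ht,
      (mul_eq_zero.1 (?_ : b * _ = 0)).resolve_right ht⟩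
    · linear_combination ψ q * hφ - φ q * hψ
    · linear_combination φ p * hψ - ψ p * hφ

end Generic

section Planes

variable {A : Type*} [AddCommGroup A] [Module ℝ A] [FiniteDimensional ℝ A]
  {m : A →ₗ[ℝ] A →ₗ[ℝ] A} {U T P : Submodule ℝ A}

theorem IsPlane.span_sq_eq (hU : IsPlane m U) {x : A} (hx : x ∈ U)
    (hli : LinearIndependent ℝ ![x, m x x]) : Submodule.span ℝ {x, m x x} = U :=
  span_pair_eq hU.2.le hx (hU.1 x hx x hx) hli

theorem IsPlane.eq_of_le (hU : IsPlane m U) (hT : IsPlane m T) (h : U ≤ T) : U = T :=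
  Submodule.eq_of_le_of_finrank_eq h (hU.2.trans hT.2.symm)

theorem IsPlane.span_idem_eq (hU : IsPlane m U) {e f : A} (he : IsIdem m e) (hf : IsIdem m f)
    (hef : e ≠ f) (heU : e ∈ U) (hfU : f ∈ U) : Submodule.span ℝ {e, f} = U :=
  span_pair_eq hU.2.le heU hfU (he.linearIndependent hf hef)

namespace PlanarPowers

variable (h : PlanarPowers m)
include h

omit [FiniteDimensional ℝ A] in
theorem isPlane_span {x : A} (hx : LinearIndependent ℝ ![x, m x x]) :
    IsPlane m (Submodule.span ℝ {x, m x x}) :=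
  ⟨h.isSubalg x, finrank_span_pair hx⟩

theorem exists_span_sq_eq (hU : IsPlane m U) :
    ∃ x ∈ U, LinearIndependent ℝ ![x, m x x] ∧ Submodule.span ℝ {x, m x x} = U := by
  obtain ⟨x, hx, hli⟩ := exists_linearIndependent_sq h.eq_zero_or hU.2.ge
  exact ⟨x, hx, hli, hU.span_sq_eq hx hli⟩

theorem mul_comm_of_isPlane (hU : IsPlane m U) {x y : A} (hx : x ∈ U) (hy : y ∈ U) :
    m x y = m y x := by
  obtain ⟨z, -, -, rfl⟩ := h.exists_span_sq_eq hU
  rw [Submodule.mem_span_pair] at hx hy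
  obtain ⟨a, b, rfl⟩ := hx
  obtain ⟨c, d, rfl⟩ := hy
  simp only [map_add, map_smul, LinearMap.add_apply, LinearMap.smul_apply, h.sq_comm]
  module

theorem exists_isIdem_mem_inf (hU : IsPlane m U) (hT : IsPlane m T) (hUT : U ≠ T) (hUP : U ≤ P)
    (hTP : T ≤ P) (hP : finrank ℝ P ≤ 3) : ∃ e, IsIdem m e ∧ e ∈ U ∧ e ∈ T := by
  have h1 := Submodule.finrank_sup_add_finrank_inf_eq U T
  have h2 := Submodule.finrank_mono (sup_le hUP hTP)
  rw [hU.2, hT.2] at h1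
  obtain ⟨z, ⟨hzU, hzT⟩, hz⟩ := Submodule.exists_mem_ne_zero_of_ne_bot
    (Submodule.one_le_finrank_iff.1 (show 1 ≤ finrank ℝ ↥(U ⊓ T) by omega))
  have hli : ¬LinearIndependent ℝ ![z, m z z] := fun hli =>
    hUT ((hU.span_sq_eq hzU hli).symm.trans (hT.span_sq_eq hzT hli))
  obtain ⟨c, -, hc⟩ := exists_isIdem_smul h.eq_zero_or hz hli
  exact ⟨_, hc, U.smul_mem c hzU, T.smul_mem c hzT⟩

omit [FiniteDimensional ℝ A] in
theorem exists_linearIndependent_sq_notMem (hP : 2 ≤ finrank ℝ P) {s : Set (Submodule ℝ A)}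
    (hs : s.Finite) (hPs : ∀ T ∈ s, ¬P ≤ T) :
    ∃ x ∈ P, LinearIndependent ℝ ![x, m x x] ∧ ∀ T ∈ s, x ∉ T := by
  obtain ⟨y, hy, hys⟩ := LineCofinite.exists_mem_biInter hs
    (S := fun T : Submodule ℝ A => (T : Set A)ᶜ) (P := P) (fun T _ => lineCofinite_compl T)
    fun T hT => Set.not_subset.1 (hPs T hT)
  obtain ⟨x, hx, hx1, hx2⟩ := (lineCofinite_linearIndependent_sq LinearMap.id m).exists_mem_inter
    (LineCofinite.biInter hs fun T _ => lineCofinite_compl T)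
    (exists_linearIndependent_sq h.eq_zero_or hP) ⟨y, hy, Set.mem_iInter₂.2 hys⟩
  exact ⟨x, hx, hx1, Set.mem_iInter₂.1 hx2⟩

end PlanarPowers

/-- The planes other than `U` that have an idempotent in common with `U`. -/
def meetingPlanes (m : A →ₗ[ℝ] A →ₗ[ℝ] A) (U : Submodule ℝ A) : Set (Submodule ℝ A) :=
  {T | IsPlane m T ∧ T ≠ U ∧ ∃ e, IsIdem m e ∧ e ∈ U ∧ e ∈ T}

theorem exists_dual_of_finrank_eq_two (hA : finrank ℝ A = 4) (hU : finrank ℝ U = 2) :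
    ∃ (φ ψ : A →ₗ[ℝ] ℝ) (v w : A), φ v = 1 ∧ φ w = 0 ∧ ψ v = 0 ∧ ψ w = 1 ∧
      ∀ x, x ∈ U ↔ φ x = 0 ∧ ψ x = 0 := by
  have hQ : finrank ℝ (A ⧸ U) = 2 := by
    have := U.finrank_quotient_add_finrank
    omega
  obtain ⟨p, -, q, -, hpq⟩ := exists_linearIndependent_pair_mem (A := A ⧸ U) (U := ⊤)
    (by rw [finrank_top, hQ])
  have htop := span_pair_eq (U := (⊤ : Submodule ℝ (A ⧸ U))) (by rw [finrank_top, hQ]) trivial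
    trivial hpq
  obtain ⟨φ, ψ, h1, h2, h3, h4⟩ := exists_dual_pair hpq
  obtain ⟨v, rfl⟩ := U.mkQ_surjective p
  obtain ⟨w, rfl⟩ := U.mkQ_surjective q
  refine ⟨φ ∘ₗ U.mkQ, ψ ∘ₗ U.mkQ, v, w, h1, h2, h3, h4, fun x => ⟨fun hx => ?_, ?_⟩⟩
  · have : U.mkQ x = 0 := by simpa using hx
    simp [this]
  · rintro ⟨hφ, hψ⟩
    obtain ⟨a, b, hab⟩ := Submodule.mem_span_pair.1
      (show U.mkQ x ∈ Submodule.span ℝ {U.mkQ v, U.mkQ w} by rw [htop]; trivial)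
    rw [LinearMap.comp_apply, ← hab] at hφ hψ
    simp only [map_add, map_smul, h1, h2, h3, h4, smul_eq_mul, mul_one, mul_zero, add_zero,
      zero_add] at hφ hψ
    rw [hφ, hψ, zero_smul, zero_smul, add_zero] at hab
    simpa using hab.symm

theorem eq_zero_of_infinite_quadratic {a b c : ℝ}
    (h : {t : ℝ | a + t * b + t ^ 2 * c = 0}.Infinite) :
    a = 0 ∧ b = 0 ∧ c = 0 := by
  let p : Polynomial ℝ := Polynomial.C a + Polynomial.C b * Polynomial.X
    + Polynomial.C c * Polynomial.X ^ 2
  have hp : p = 0 := Polynomial.eq_zero_of_infinite_isRoot p (h.mono fun t ht => by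
    have : a + t * b + t ^ 2 * c = 0 := ht
    change p.eval t = 0
    simp only [p, Polynomial.eval_add, Polynomial.eval_mul, Polynomial.eval_C, Polynomial.eval_X,
      Polynomial.eval_pow]
    linarith)
  have hc : ∀ n, p.coeff n = 0 := by simp [hp]
  refine ⟨?_, ?_, ?_⟩
  · simpa [p, Polynomial.coeff_X, Polynomial.coeff_C] using hc 0
  · simpa [p, Polynomial.coeff_X, Polynomial.coeff_C] using hc 1
  · simpa [p, Polynomial.coeff_X, Polynomial.coeff_C] using hc 2

namespace PlanarPowers

variable (h : PlanarPowers m)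
include h

theorem not_forall_sq_mem (hU : IsPlane m U) (hfin : (meetingPlanes m U).Finite)
    (hP : finrank ℝ P = 3) (hUP : U ≤ P) : ¬∀ x ∈ P, m x x ∈ P := by
  intro hsq
  obtain ⟨x, hx, hli, hxs⟩ := h.exists_linearIndependent_sq_notMem (P := P) (by omega)
    (hfin.insert U) (by
      intro T hT hPT
      have h1 : finrank ℝ T = 2 := by
        rcases hT with rfl | hT
        exacts [hU.2, hT.1.2]
      have := Submodule.finrank_mono hPT
      omega)
  have hT := h.isPlane_span hli
  have hxT : x ∈ Submodule.span ℝ {x, m x x} := Submodule.subset_span (by simp)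
  have hne : Submodule.span ℝ {x, m x x} ≠ U := fun hTU => hxs U (by simp) (hTU ▸ hxT)
  refine hxs _ (.inr ⟨hT, hne, ?_⟩) hxT
  exact h.exists_isIdem_mem_inf hU hT hne.symm hUP
    (Submodule.span_le.2 (Set.pair_subset hx (hsq x hx))) hP.le

theorem exists_meetingPlane_le_ker (hU : IsPlane m U) {δ : A →ₗ[ℝ] ℝ} (hδ : δ ≠ 0)
    (hUδ : ∀ x ∈ U, δ x = 0) {w u : A} (hw : δ w = 0) (hwU : w ∉ U) (hu : u ∈ U)
    (huw : δ (m u w + m w u) ≠ 0) : ∃ T ∈ meetingPlanes m U, T ≤ LinearMap.ker δ := by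
  have hker : finrank ℝ (LinearMap.ker δ) = 3 := by
    have := Module.Dual.finrank_ker_add_one_of_ne_zero hδ
    have := h.finrank_eq
    omega
  obtain ⟨β, hβ⟩ : ∃ β : ℝ, δ (m w w) + β * δ (m u w + m w u) = 0 :=
    ⟨-δ (m w w) / δ (m u w + m w u), by field_simp; ring⟩
  let x := w + β • u
  have hxx : δ (m x x) = 0 := by
    have h1 := hUδ _ (hU.1 u hu u hu)
    simp only [x, map_add, map_smul, LinearMap.add_apply, LinearMap.smul_apply, smul_eq_mul,
      h1] at hβ ⊢
    linarith
  have hxU : x ∉ U := fun hx => hwU ((U.add_mem_iff_left (U.smul_mem β hu)).1 hx)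
  have hx : δ x = 0 := by simp [x, hw, hUδ u hu]
  let f : U →ₗ[ℝ] ℝ := (δ ∘ₗ (m.flip x + m x)) ∘ₗ U.subtype
  obtain ⟨⟨v, hv⟩, hvf, hv0⟩ := Submodule.exists_mem_ne_zero_of_ne_bot
    (LinearMap.ker_ne_bot_of_finrank_lt (f := f) (by rw [hU.2, finrank_self]; norm_num))
  have hvx : δ (m v x + m x v) = 0 := hvf
  have hli : LinearIndependent ℝ ![v, x] := by
    rw [LinearIndependent.pair_iff' (by simpa using hv0)]
    exact fun a ha => hxU (ha ▸ U.smul_mem a hv)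
  have hV : ∀ z ∈ Submodule.span ℝ {v, x}, δ z = 0 ∧ δ (m z z) = 0 := by
    intro z hz
    obtain ⟨a, b, rfl⟩ := Submodule.mem_span_pair.1 hz
    have h1 := hUδ _ (hU.1 v hv v hv)
    have h2 := hUδ v hv
    rw [map_add] at hvx
    simp only [map_add, map_smul, LinearMap.add_apply, LinearMap.smul_apply, smul_eq_mul, h1, h2,
      hx, hxx]
    exact ⟨by ring, by linear_combination a * b * hvx⟩
  obtain ⟨z, hz, hzli, hzU⟩ := h.exists_linearIndependent_sq_notMem
    (finrank_span_pair hli).ge (Set.finite_singleton U) (by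
      intro T hT hle
      rw [Set.mem_singleton_iff.1 hT] at hle
      exact hxU (hle (Submodule.subset_span (by simp))))
  have hT := h.isPlane_span hzli
  have hTk : Submodule.span ℝ {z, m z z} ≤ LinearMap.ker δ :=
    Submodule.span_le.2 (Set.pair_subset (hV z hz).1 (hV z hz).2)
  have hne : Submodule.span ℝ {z, m z z} ≠ U := fun hTU =>
    hzU U rfl (hTU ▸ Submodule.subset_span (by simp))
  exact ⟨_, ⟨hT, hne, h.exists_isIdem_mem_inf hU hT hne.symm hUδ hTk hker.le⟩, hTk⟩

theorem meetingPlanes_infinite (hU : IsPlane m U) : (meetingPlanes m U).Infinite := by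
  intro hfin
  obtain ⟨φ, ψ, v, w, hφv, hφw, hψv, hψw, hmem⟩ := exists_dual_of_finrank_eq_two h.finrank_eq hU.2
  let bad : Set ℝ := {t | ∃ T ∈ meetingPlanes m U, T ≤ LinearMap.ker (ψ - t • φ)}
  have hbad : bad.Finite := by
    choose! T hT hTle using fun (t : ℝ) (ht : t ∈ bad) => ht
    refine Set.Finite.of_finite_image (f := T)
      (hfin.subset (Set.image_subset_iff.2 fun t ht => hT t ht)) fun t ht s hs hts => ?_
    by_contra hne
    refine (hT t ht).2.1 ((hT t ht).1.eq_of_le hU fun x hx => (hmem x).2 ?_)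
    have h1 : ψ x - t * φ x = 0 := hTle t ht hx
    have h2 : ψ x - s * φ x = 0 := hTle s hs (hts ▸ hx)
    have h3 : φ x = 0 := by
      refine (mul_eq_zero.1 (?_ : (t - s) * φ x = 0)).resolve_left (sub_ne_zero.2 hne)
      linear_combination h2 - h1
    exact ⟨h3, by simpa [h3] using h1⟩
  have hcoef : ∀ u ∈ U, ψ (m u v + m v u) = 0 ∧
      ψ (m u w + m w u) - φ (m u v + m v u) = 0 ∧ -φ (m u w + m w u) = 0 := by
    intro u hu
    refine eq_zero_of_infinite_quadratic (hbad.infinite_compl.mono fun t ht => ?_)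
    rw [Set.mem_ofPred_eq]
    by_contra hne
    refine ht (h.exists_meetingPlane_le_ker hU (δ := ψ - t • φ) (w := v + t • w) (u := u) ?_ ?_ ?_
      ?_ hu ?_)
    · intro h0
      have := LinearMap.congr_fun h0 w
      simp [hφw, hψw] at this
    · intro x hx
      simp [(hmem x).1 hx]
    · simp [hφv, hφw, hψv, hψw]
    · intro hvw
      have := ((hmem _).1 hvw).1
      simp [hφv, hφw] at this
    · intro h0
      apply hne
      simp only [map_add, map_smul, LinearMap.add_apply, LinearMap.smul_apply, LinearMap.sub_apply,
        smul_eq_mul] at h0 ⊢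
      linear_combination h0
  let z : ℝ → A := fun θ => Real.cos θ • v + Real.sin θ • w
  let g : ℝ → ℝ := fun θ => Real.sin θ * φ (m (z θ) (z θ)) - Real.cos θ * ψ (m (z θ) (z θ))
  obtain ⟨θ, hθ⟩ := exists_zero_of_antiperiodic (g := g)
    (by
      simp only [g, z, map_add, map_smul, LinearMap.add_apply, LinearMap.smul_apply, smul_eq_mul]
      fun_prop)
    (by simp [g, z])
  simp only [g] at hθ
  have hcs := Real.cos_sq_add_sin_sq θ
  set s := Real.cos θ
  set t := Real.sin θ
  let δ : A →ₗ[ℝ] ℝ := t • φ - s • ψ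
  have hδ : ∀ x, δ x = t * φ x - s * ψ x := fun x => rfl
  have hδ0 : δ ≠ 0 := by
    intro h0
    have h1 := LinearMap.congr_fun h0 v
    have h2 := LinearMap.congr_fun h0 w
    simp only [hδ, hφv, hφw, hψv, hψw, LinearMap.zero_apply] at h1 h2
    nlinarith
  have hker : finrank ℝ (LinearMap.ker δ) = 3 := by
    have := Module.Dual.finrank_ker_add_one_of_ne_zero hδ0
    have := h.finrank_eq
    omega
  refine h.not_forall_sq_mem hU hfin hker (fun x hx => ?_) fun x hx => ?_
  · rw [LinearMap.mem_ker, hδ, ((hmem x).1 hx).1, ((hmem x).1 hx).2]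
    ring
  · rw [LinearMap.mem_ker, hδ] at hx
    obtain ⟨r, u, hu, rfl⟩ : ∃ r : ℝ, ∃ u ∈ U, u + r • z θ = x := by
      refine ⟨s * φ x + t * ψ x, _, ?_, sub_add_cancel x _⟩
      rw [hmem]
      simp only [z, map_sub, map_smul, map_add, hφv, hφw, hψv, hψw, smul_eq_mul]
      constructor
      · linear_combination (-φ x) * hcs + t * hx
      · linear_combination (-ψ x) * hcs - s * hx
    obtain ⟨h1, h2, h3⟩ := hcoef u hu
    obtain ⟨h4, h5⟩ := (hmem _).1 (hU.1 u hu u hu)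
    have hcross : t * φ (m u (z θ) + m (z θ) u) - s * ψ (m u (z θ) + m (z θ) u) = 0 := by
      simp only [z, map_add, map_smul, LinearMap.add_apply, LinearMap.smul_apply,
        smul_eq_mul] at h1 h2 h3 ⊢
      linear_combination -t * s * h2 - t ^ 2 * h3 - s ^ 2 * h1
    rw [LinearMap.mem_ker, hδ]
    generalize z θ = y at *
    simp only [map_add, map_smul, LinearMap.add_apply, LinearMap.smul_apply, smul_eq_mul, h4,
      h5] at hcross ⊢
    linear_combination r * hcross + r ^ 2 * hθ

theorem exists_isIdem_infinite (hU : IsPlane m U) :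
    ∃ e ∈ U, IsIdem m e ∧ {T | IsPlane m T ∧ e ∈ T}.Infinite := by
  by_contra! hn
  refine h.meetingPlanes_infinite hU (((finite_isIdem h.eq_zero_or hU.2.le).biUnion
    fun e he => hn e he.2 he.1).subset ?_)
  rintro T ⟨hT, -, e, he, heU, heT⟩
  exact Set.mem_biUnion (⟨he, heU⟩ : IsIdem m e ∧ e ∈ U) ⟨hT, heT⟩

end PlanarPowers

end Planes

section Idempotents

variable {A : Type*} [AddCommGroup A] [Module ℝ A] {m : A →ₗ[ℝ] A →ₗ[ℝ] A}

theorem mem_centraliser {e x : A} : x ∈ centraliser m e ↔ m e x = m x e := by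
  simp [centraliser, sub_eq_zero]

/-- The planes through `e`. -/
def planesThrough (m : A →ₗ[ℝ] A →ₗ[ℝ] A) (e : A) : Set (Submodule ℝ A) :=
  {T | IsPlane m T ∧ e ∈ T}

namespace PlanarPowers

variable [FiniteDimensional ℝ A] (h : PlanarPowers m)
include h

theorem le_centraliser {e : A} {T : Submodule ℝ A} (hT : T ∈ planesThrough m e) :
    T ≤ centraliser m e := fun _ hx =>
  mem_centraliser.2 (h.mul_comm_of_isPlane hT.1 hT.2 hx)

theorem eq_sup_of_mem_planesThrough {e : A} (hC : centraliser m e ≠ ⊤) {U V : Submodule ℝ A}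
    (hU : U ∈ planesThrough m e) (hV : V ∈ planesThrough m e) (hUV : U ≠ V) :
    finrank ℝ (centraliser m e) = 3 ∧ U ⊔ V = centraliser m e := by
  have hle := sup_le (h.le_centraliser hU) (h.le_centraliser hV)
  have h1 := Submodule.finrank_sup_add_finrank_inf_eq U V
  have h2 := Submodule.finrank_lt hC
  have h3 := Submodule.finrank_mono hle
  have h4 : finrank ℝ ↥(U ⊓ V) < finrank ℝ U := Submodule.finrank_lt_finrank_of_lt
    (inf_le_left.lt_of_ne fun hi => hUV (hU.1.eq_of_le hV.1 (inf_eq_left.1 hi)))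
  rw [hU.1.2] at h1 h4
  rw [hV.1.2] at h1
  rw [h.finrank_eq] at h2
  exact ⟨by omega, Submodule.eq_of_le_of_finrank_le hle (by omega)⟩

theorem sq_mem_centraliser {e : A} (he : e ≠ 0) (hinf : (planesThrough m e).Infinite)
    (hC : centraliser m e ≠ ⊤) {x : A} (hx : x ∈ centraliser m e) :
    m x x ∈ centraliser m e := by
  obtain ⟨U, hU⟩ := hinf.nonempty
  obtain ⟨V, hV, hVU⟩ := hinf.exists_notMem_finite (Set.finite_singleton U)
  obtain ⟨W, hW, hWUV⟩ := hinf.exists_notMem_finite (Set.toFinite {U, V})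
  simp only [Set.mem_singleton_iff, Set.mem_insert_iff, not_or] at hVU hWUV
  have hsup := (h.eq_sup_of_mem_planesThrough hC hU hV (Ne.symm hVU)).2
  obtain ⟨c, hcW, hce⟩ : ∃ c ∈ W, c ∉ Submodule.span ℝ {e} := by
    refine Set.not_subset.1 fun hle => ?_
    have h1 := Submodule.finrank_mono hle
    rw [finrank_span_singleton he, hW.1.2] at h1
    omega
  have hli : ∀ {z : A}, z ∉ Submodule.span ℝ {e} → LinearIndependent ℝ ![e, z] := fun hz =>
    (LinearIndependent.pair_iff' he).2 fun a ha =>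
      hz (ha ▸ Submodule.smul_mem _ a (Submodule.mem_span_singleton_self e))
  have hcnot : ∀ T ∈ planesThrough m e, W ≠ T → c ∉ T := fun T hT hWT hcT =>
    hWT ((span_pair_eq hW.1.2.le hW.2 hcW (hli hce)).symm.trans
      (span_pair_eq hT.1.2.le hT.2 hcT (hli hce)))
  obtain ⟨u, hu, v, hv, rfl⟩ := Submodule.mem_sup.1 (hsup ▸ h.le_centraliser hW hcW)
  have hspan : ∀ {T : Submodule ℝ A}, e ∈ T → Submodule.span ℝ {e} ≤ T := fun heT =>
    Submodule.span_le.2 (Set.singleton_subset_iff.2 heT)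
  have hU' := span_pair_eq hU.1.2.le hU.2 hu (hli fun hue =>
    hcnot V hV hWUV.2 (V.add_mem (hspan hV.2 hue) hv))
  have hV' := span_pair_eq hV.1.2.le hV.2 hv (hli fun hve =>
    hcnot U hU hWUV.1 (U.add_mem hu (hspan hU.2 hve)))
  have hUC := h.le_centraliser hU
  have hVC := h.le_centraliser hV
  set C := centraliser m e
  have huv : m u v + m v u ∈ C := by
    have h1 := h.le_centraliser hW (hW.1.1 _ hcW _ hcW)
    have h2 := C.sub_mem (C.sub_mem h1 (hUC (hU.1.1 u hu u hu))) (hVC (hV.1.1 v hv v hv))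
    convert! h2 using 1
    simp only [map_add, LinearMap.add_apply]
    abel
  obtain ⟨y, hy, z, hz, rfl⟩ := Submodule.mem_sup.1 (hsup ▸ hx)
  have hyy := hUC (hU.1.1 y hy y hy)
  have hzz := hVC (hV.1.1 z hz z hz)
  rw [← hU', Submodule.mem_span_pair] at hy
  rw [← hV', Submodule.mem_span_pair] at hz
  obtain ⟨a, b, rfl⟩ := hy
  obtain ⟨a', b', rfl⟩ := hz
  have hsum := C.add_mem (C.add_mem (C.add_mem hyy hzz)
      (C.smul_mem (2 * a * a') (hUC (hU.1.1 e hU.2 e hU.2)))) (C.add_mem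
    (C.add_mem (C.smul_mem (a * b') (hVC (V.add_mem (hV.1.1 e hV.2 v hv) (hV.1.1 v hv e hV.2))))
      (C.smul_mem (a' * b) (hUC (U.add_mem (hU.1.1 e hU.2 u hu) (hU.1.1 u hu e hU.2)))))
    (C.smul_mem (b * b') huv))
  convert! hsum using 1
  simp only [map_add, map_smul, LinearMap.add_apply, LinearMap.smul_apply]
  module

theorem mem_span_sq_of_mem_centraliser {e : A} (he : IsIdem m e)
    (hinf : (planesThrough m e).Infinite) (hC : centraliser m e ≠ ⊤) {x : A}
    (hx : x ∈ centraliser m e) (hli : LinearIndependent ℝ ![x, m x x]) :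
    e ∈ Submodule.span ℝ {x, m x x} := by
  by_contra heT
  have hT := h.isPlane_span hli
  have hTC : Submodule.span ℝ {x, m x x} ≤ centraliser m e :=
    Submodule.span_le.2 (Set.pair_subset hx (h.sq_mem_centraliser he.1 hinf hC hx))
  have h2 := Submodule.finrank_lt hC
  rw [h.finrank_eq] at h2
  refine hinf (((finite_isIdem h.eq_zero_or hT.2.le).image
    fun f => Submodule.span ℝ {e, f}).subset fun W hW => ?_)
  obtain ⟨f, hf, hfW, hfT⟩ := h.exists_isIdem_mem_inf hW.1 hT
    (fun hWT => heT (hWT ▸ hW.2)) (h.le_centraliser hW) hTC (by omega)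
  exact ⟨f, ⟨hf, hfT⟩, hW.1.span_idem_eq he hf (fun hef => heT (hef ▸ hfT)) hW.2 hfW⟩

theorem exists_span_sq_eq_span_pair {e f : A} (he : IsIdem m e)
    (hinf : (planesThrough m e).Infinite) (hC : centraliser m e ≠ ⊤) (hf : IsIdem m f)
    (hinf' : (planesThrough m f).Infinite) (hC' : centraliser m f ≠ ⊤) (hef : e ≠ f) :
    ∃ x, LinearIndependent ℝ ![x, m x x] ∧
      Submodule.span ℝ {e, f} = Submodule.span ℝ {x, m x x} := by
  have h3 : ∀ g, (planesThrough m g).Infinite → centraliser m g ≠ ⊤ →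
      finrank ℝ (centraliser m g) = 3 := fun g hg hCg => by
    obtain ⟨U, hU⟩ := hg.nonempty
    obtain ⟨V, hV, hVU⟩ := hg.exists_notMem_finite (Set.finite_singleton U)
    exact (h.eq_sup_of_mem_planesThrough hCg hU hV (Ne.symm hVU)).1
  have h1 := Submodule.finrank_sup_add_finrank_inf_eq (centraliser m e) (centraliser m f)
  have h2 := Submodule.finrank_le (centraliser m e ⊔ centraliser m f)
  rw [h3 e hinf hC, h3 f hinf' hC'] at h1
  rw [h.finrank_eq] at h2
  obtain ⟨x, ⟨hxe, hxf⟩, hli⟩ := exists_linearIndependent_sq h.eq_zero_or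
    (V := centraliser m e ⊓ centraliser m f) (by omega)
  exact ⟨x, hli, (h.isPlane_span hli).span_idem_eq he hf hef
    (h.mem_span_sq_of_mem_centraliser he hinf hC hxe hli)
    (h.mem_span_sq_of_mem_centraliser hf hinf' hC' hxf hli)⟩

theorem finite_noncentral_isIdem :
    {e | IsIdem m e ∧ (planesThrough m e).Infinite ∧ centraliser m e ≠ ⊤}.Finite := by
  rcases Set.subsingleton_or_nontrivial
    {e | IsIdem m e ∧ (planesThrough m e).Infinite ∧ centraliser m e ≠ ⊤} with hs | hs
  · exact hs.finite
  obtain ⟨f, ⟨hf, hfi, hfC⟩, g, ⟨hg, hgi, hgC⟩, hfg⟩ := hs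
  refine (finite_isIdem h.eq_zero_or (finrank_span_pair (hf.linearIndependent hg hfg)).le).subset ?_
  rintro e ⟨he, hei, heC⟩
  refine ⟨he, ?_⟩
  have hcomm : ∀ k, IsIdem m k → (planesThrough m k).Infinite → centraliser m k ≠ ⊤ →
      k ∈ centraliser m e := fun k hk hki hkC => by
    rcases eq_or_ne e k with rfl | hek
    · exact mem_centraliser.2 rfl
    obtain ⟨x, hx, hspan⟩ := h.exists_span_sq_eq_span_pair he hei heC hk hki hkC hek
    have hT := h.isPlane_span hx
    rw [← hspan] at hT
    exact mem_centraliser.2 (h.mul_comm_of_isPlane hT (Submodule.subset_span (by simp))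
      (Submodule.subset_span (by simp)))
  obtain ⟨x, hx, hspan⟩ := h.exists_span_sq_eq_span_pair hf hfi hfC hg hgi hgC hfg
  have hxC : x ∈ centraliser m e := Submodule.span_le.2
    (Set.pair_subset (hcomm f hf hfi hfC) (hcomm g hg hgi hgC))
    (hspan ▸ Submodule.subset_span (by simp))
  rw [hspan]
  exact h.mem_span_sq_of_mem_centraliser he hei heC hxC hx

theorem finite_central_isIdem : {e | IsIdem m e ∧ centraliser m e = ⊤}.Finite := by
  let Z := LinearMap.ker (m - m.flip)
  have hZ : ∀ {z}, z ∈ Z ↔ ∀ y, m z y = m y z := by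
    intro z
    simp [Z, LinearMap.ext_iff, sub_eq_zero]
  have hZ2 : finrank ℝ Z ≤ 2 := by
    by_contra! hlt
    obtain ⟨a, y, hay⟩ := h.not_comm
    have hyZ : y ∉ Z := fun hy => hay (hZ.1 hy a).symm
    have htop : Z ⊔ Submodule.span ℝ {y} = ⊤ := by
      refine Submodule.eq_top_of_finrank_eq (le_antisymm (Submodule.finrank_le _) ?_)
      have := Submodule.finrank_lt_finrank_of_lt (show Z < Z ⊔ Submodule.span ℝ {y} by simpa)
      have := h.finrank_eq
      omega
    obtain ⟨z, hz, w, hw, rfl⟩ := Submodule.mem_sup.1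
      (show a ∈ Z ⊔ Submodule.span ℝ {y} by rw [htop]; trivial)
    obtain ⟨t, rfl⟩ := Submodule.mem_span_singleton.1 hw
    exact hay (by simp [hZ.1 hz y])
  refine (finite_isIdem h.eq_zero_or hZ2).subset fun e he => ⟨he.1, hZ.2 fun y => ?_⟩
  exact mem_centraliser.1 (show y ∈ centraliser m e by rw [he.2]; trivial)

theorem exists_omnipresent : ∃ e, Omnipresent m e := by
  by_contra! hno
  have hfin : {e | IsIdem m e ∧ (planesThrough m e).Infinite}.Finite := by
    refine (h.finite_noncentral_isIdem.union h.finite_central_isIdem).subset fun e he => ?_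
    by_cases hC : centraliser m e = ⊤
    exacts [.inr ⟨he.1, hC⟩, .inl ⟨he.1, he.2, hC⟩]
  let S : A → Set A := fun e => {y | LinearIndependent ℝ
    ![(Submodule.span ℝ {e}).mkQ y, m.compr₂ (Submodule.span ℝ {e}).mkQ y y]}
  have hS : ∀ e, LineCofinite (S e) := fun e => lineCofinite_linearIndependent_sq _ _
  have hne : ∀ e ∈ {e | IsIdem m e ∧ (planesThrough m e).Infinite}, ∃ x ∈ (⊤ : Submodule ℝ A),
      x ∈ S e := by
    rintro e ⟨he, -⟩
    obtain ⟨U, hUalg, hU2, heU⟩ : ∃ U, IsSubalg m U ∧ finrank ℝ U = 2 ∧ e ∉ U := by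
      by_contra! hU
      exact hno e ⟨he.1, he.2, hU⟩
    obtain ⟨x, -, hli, rfl⟩ := h.exists_span_sq_eq ⟨hUalg, hU2⟩
    refine ⟨x, trivial, LinearIndependent.pair_iff.2 fun a b hab => ?_⟩
    rw [LinearMap.compr₂_apply, ← map_smul, ← map_smul, ← map_add, Submodule.mkQ_apply,
      Submodule.Quotient.mk_eq_zero, Submodule.mem_span_singleton] at hab
    obtain ⟨c, hc⟩ := hab
    have hc0 : c = 0 := by
      by_contra hc0
      exact heU ((Submodule.smul_mem_iff _ hc0).1 (Submodule.mem_span_pair.2 ⟨a, b, hc.symm⟩))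
    rw [hc0, zero_smul] at hc
    exact LinearIndependent.pair_iff.1 hli a b hc.symm
  obtain ⟨x, -, hx⟩ := LineCofinite.exists_mem_biInter hfin (fun e _ => hS e) hne
  obtain ⟨y, -, hy1, hy2⟩ := (lineCofinite_linearIndependent_sq LinearMap.id m).exists_mem_inter
    (LineCofinite.biInter hfin fun e _ => hS e)
    (exists_linearIndependent_sq h.eq_zero_or (V := ⊤) (by rw [finrank_top, h.finrank_eq]; simp))
    ⟨x, trivial, Set.mem_iInter₂.2 hx⟩
  obtain ⟨e, heT, he, hinf⟩ := h.exists_isIdem_infinite (h.isPlane_span hy1)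
  have hyS : y ∈ S e := Set.mem_iInter₂.1 hy2 e ⟨he, hinf⟩
  obtain ⟨a, b, hab⟩ := Submodule.mem_span_pair.1 heT
  have h0 : a • (Submodule.span ℝ {e}).mkQ y + b • m.compr₂ (Submodule.span ℝ {e}).mkQ y y = 0 := by
    have hab' : a • y + b • m y y = e := hab
    rw [LinearMap.compr₂_apply, ← map_smul, ← map_smul, ← map_add, hab', Submodule.mkQ_apply,
      Submodule.Quotient.mk_eq_zero]
    exact Submodule.mem_span_singleton_self e
  obtain ⟨rfl, rfl⟩ := LinearIndependent.pair_iff.1 hyS a b h0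
  exact he.1 (by simpa using hab.symm)

end PlanarPowers

end Idempotents

/-- Every four-dimensional power-commutative real division algebra
contains an omnipresent idempotent. -/
theorem stmt_0 {A : Type*} [AddCommGroup A] [Module ℝ A] [FiniteDimensional ℝ A]
    (m : A →ₗ[ℝ] A →ₗ[ℝ] A)
    (hdim : Module.finrank ℝ A = 4)
    (hdiv : IsDivision m) (hpc : PowerComm m) :
    ∃ e : A, Omnipresent m e := by
  exact (PlanarPowers.of_powerComm hdim hdiv hpc).exists_omnipresent
end

section
/- A finite-dimensional real division algebra A is power-commutative if and only if A is third-power associative (x·x² = x²·x for all x ∈ A) and for every x ∈ A the linear span of {x, x²} is a subalgebra of A. -/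
open Module

section Hopf

variable {E : Type*} [NormedAddCommGroup E] [NormedSpace ℝ E]

/-- In a commutative algebra without zero divisors, square roots are unique up to sign. -/
theorem eq_or_eq_neg_of_bilin_self_eq (B : E →L[ℝ] E →L[ℝ] E)
    (hcomm : ∀ x y, B x y = B y x) (hzero : ∀ x y, B x y = 0 → x = 0 ∨ y = 0) {x y : E}
    (h : B x x = B y y) : x = y ∨ x = -y := by
  have : B (x - y) (x + y) = 0 := by
    simp only [map_sub, map_add, sub_apply, h, hcomm y x]
    abel
  exact (hzero _ _ this).imp sub_eq_zero.1 eq_neg_of_add_eq_zero_left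

variable [FiniteDimensional ℝ E]

theorem isProperMap_bilin_self (B : E →L[ℝ] E →L[ℝ] E)
    (hzero : ∀ x y, B x y = 0 → x = 0 ∨ y = 0) : IsProperMap fun x => B x x := by
  have hcont : Continuous fun x => B x x := by fun_prop
  have := FiniteDimensional.proper ℝ E
  refine isProperMap_iff_tendsto_cocompact.2 ⟨hcont, ?_⟩
  rcases subsingleton_or_nontrivial E with hE | hE
  · simp [Filter.cocompact_eq_bot]
  rw [← Metric.cobounded_eq_cocompact, ← comap_norm_atTop, Filter.tendsto_comap_iff, comap_norm_atTop,
    Metric.cobounded_eq_cocompact]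
  obtain ⟨x₀, hx₀, hmin⟩ := (isCompact_sphere (0 : E) 1).exists_isMinOn
    (NormedSpace.sphere_nonempty.2 zero_le_one) hcont.norm.continuousOn
  have hc : 0 < ‖B x₀ x₀‖ := by
    refine norm_pos_iff.2 fun h => ?_
    have : x₀ = 0 := (hzero _ _ h).elim id id
    simp [this] at hx₀
  have hbound : ∀ x, ‖B x₀ x₀‖ * ‖x‖ ^ 2 ≤ ‖B x x‖ := by
    intro x
    rcases eq_or_ne x 0 with rfl | hx
    · simp
    have hx' : 0 < ‖x‖ := norm_pos_iff.2 hx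
    have h := hmin (show ‖x‖⁻¹ • x ∈ Metric.sphere (0 : E) 1 by
      simp [norm_smul, hx'.ne'])
    simp only [Set.mem_ofPred_eq, map_smul, smul_apply, norm_smul, norm_inv,
      norm_norm] at h
    calc ‖B x₀ x₀‖ * ‖x‖ ^ 2 ≤ (‖x‖⁻¹ * (‖x‖⁻¹ * ‖B x x‖)) * ‖x‖ ^ 2 := by gcongr
      _ = ‖B x x‖ := by field_simp
  refine Filter.tendsto_atTop_mono hbound ?_
  exact ((Filter.tendsto_pow_atTop two_ne_zero).comp
    (tendsto_norm_cocompact_atTop)).const_mul_atTop hc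

theorem isLocalHomeomorphOn_bilin_self (B : E →L[ℝ] E →L[ℝ] E)
    (hcomm : ∀ x y, B x y = B y x) (hzero : ∀ x y, B x y = 0 → x = 0 ∨ y = 0) :
    IsLocalHomeomorphOn (fun x => B x x) {0}ᶜ := by
  have := FiniteDimensional.complete ℝ E
  intro a ha
  have hinj : Function.Injective ((2 : ℝ) • (B a : E →ₗ[ℝ] E)) := by
    refine (injective_iff_map_eq_zero _).2 fun h hh => ?_
    exact (hzero a h (by simpa using hh)).resolve_left ha
  let e : E ≃L[ℝ] E := (LinearEquiv.ofInjectiveEndo _ hinj).toContinuousLinearEquiv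
  have hd : HasStrictFDerivAt (fun x => B x x) (e : E →L[ℝ] E) a := by
    convert! B.hasStrictFDerivAt_of_bilinear (hasStrictFDerivAt_id a) (hasStrictFDerivAt_id a)
      using 1
    ext h
    change (2 : ℝ) • B a h = B a h + B h a
    rw [hcomm h a, two_smul]
  exact ⟨hd.toOpenPartialHomeomorph _, hd.mem_toOpenPartialHomeomorph_source, rfl⟩

theorem isCoveringMapOn_bilin_self (B : E →L[ℝ] E →L[ℝ] E)
    (hcomm : ∀ x y, B x y = B y x) (hzero : ∀ x y, B x y = 0 → x = 0 ∨ y = 0) :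
    IsCoveringMapOn (fun x => B x x) {0}ᶜ := by
  refine (isProperMap_bilin_self B hzero).isClosedMap.isCoveringMapOn_of_isLocalHomeomorphOn
    (fun y _ => ?_) ?_
  · rcases (((fun x => B x x) ⁻¹' {y}).eq_empty_or_nonempty) with h | ⟨x, rfl⟩
    · simp [h]
    · refine (Set.toFinite {x, -x}).subset fun z hz => ?_
      simpa using eq_or_eq_neg_of_bilin_self_eq B hcomm hzero hz
  · convert! isLocalHomeomorphOn_bilin_self B hcomm hzero using 1
    ext x
    have : B x x = 0 ↔ x = 0 := ⟨fun h => (hzero _ _ h).elim id id, fun h => by simp [h]⟩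
    simp [this]

/-- The complement of the closed ray from the origin through `p`. -/
def rayCompl (p : E) : Set E := ((fun t : ℝ => t • p) '' Set.Ici 0)ᶜ

omit [FiniteDimensional ℝ E] in
theorem isOpen_rayCompl (p : E) : IsOpen (rayCompl p) :=
  (isClosedMap_smul_left p _ isClosed_Ici).isOpen_compl

/-- **Hopf's theorem**: a commutative real division algebra has dimension at most two.
If the dimension is at least three, squaring is a double covering of the punctured space, hence
has a continuous section over the complement of the ray through `w²`. Its preimage, the complement
of the line through `w`, is connected, so the section composed with squaring is either the identity or negation there,
although it takes the same value at `x` and `-x`. -/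
theorem finrank_le_two_of_comm_bilin (B : E →L[ℝ] E →L[ℝ] E)
    (hcomm : ∀ x y, B x y = B y x) (hzero : ∀ x y, B x y = 0 → x = 0 ∨ y = 0) :
    finrank ℝ E ≤ 2 := by
  by_contra! hdim
  have : Nontrivial E := Module.nontrivial_of_finrank_pos (R := ℝ) (by omega)
  obtain ⟨w, hw⟩ := exists_ne (0 : E)
  set p := B w w
  have hp0 : p ≠ 0 := fun h => hw ((hzero _ _ h).elim id id)
  have hmemU : ∀ u, u ∈ rayCompl p ↔ ∀ t : ℝ, 0 ≤ t → t • p ≠ u := by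
    simp [rayCompl]
  have hUstar : StarConvex ℝ (-p) (rayCompl p) := by
    intro y hy a b ha hb hab
    rw [hmemU] at hy ⊢
    intro t ht h
    have h' : b • y = (t + a) • p := by rw [add_smul, h]; simp
    rcases hb.eq_or_lt with rfl | hb
    · have : t + a = 0 := by simpa [hp0] using h'.symm
      linarith
    · refine hy ((t + a) / b) (by positivity) ?_
      rw [div_eq_inv_mul, mul_smul, ← h', inv_smul_smul₀ hb.ne']
  have hpU : -p ∈ rayCompl p := by
    rw [hmemU]
    intro t ht h
    have : (t + 1) • p = 0 := by rw [add_smul, h]; simp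
    simp only [smul_eq_zero, hp0, or_false] at this
    linarith
  let L : Submodule ℝ E := Submodule.span ℝ {w}
  have hLU : ∀ x, x ∉ L → B x x ∈ rayCompl p := by
    intro x hx
    rw [hmemU]
    intro t ht h
    have : B x x = B (√t • w) (√t • w) := by
      simp only [map_smul, smul_apply, smul_smul, Real.mul_self_sqrt ht]
      exact h.symm
    have hmem : √t • w ∈ L := L.smul_mem _ (Submodule.mem_span_singleton_self w)
    rcases eq_or_eq_neg_of_bilin_self_eq B hcomm hzero this with rfl | rfl
    · exact hx hmem
    · exact hx (L.neg_mem hmem)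
  have hconn : IsConnected ((L : Set E)ᶜ) := by
    refine isConnected_compl_of_one_lt_codim ?_
    rw [← Module.finrank_eq_rank]
    have h1 := L.finrank_quotient_add_finrank
    have h2 : finrank ℝ L = 1 := finrank_span_singleton hw
    exact_mod_cast (by omega : 1 < finrank ℝ (E ⧸ L))
  obtain ⟨x₀, hx₀⟩ := hconn.nonempty
  have hU0 : ∀ u : rayCompl p, (u : E) ∈ ({0}ᶜ : Set E) := fun u h =>
    (hmemU u).1 u.2 0 le_rfl (by simpa using h.symm)
  have := hUstar.contractibleSpace ⟨_, hpU⟩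
  have : LocallyPathConnectedSpace (rayCompl p) := (isOpen_rayCompl p).locallyPathConnectedSpace
  obtain ⟨σ, ⟨-, hσ⟩, -⟩ :=
    (isCoveringMapOn_bilin_self B hcomm hzero).existsUnique_continuousMap_lifts
      (⟨Subtype.val, continuous_subtype_val⟩ : C(rayCompl p, E)) (a₀ := ⟨B x₀ x₀, hLU _ hx₀⟩)
      (e₀ := x₀) rfl hU0
  let X := ((L : Set E)ᶜ : Set E)
  have : ConnectedSpace X := isConnected_iff_connectedSpace.1 hconn
  let g : X → E := fun x => σ ⟨B x x, hLU _ x.2⟩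
  have hg : Continuous g := by fun_prop
  have hgsq : ∀ x : X, g x = x ∨ g x = -x := fun x =>
    eq_or_eq_neg_of_bilin_self_eq B hcomm hzero
      (congrFun hσ ⟨B x x, hLU _ x.2⟩)
  have hne : ∀ x : X, (x : E) ≠ -x := fun x h => by
    have h2 : (2 : ℝ) • (x : E) = 0 := by
      rw [two_smul]
      exact eq_neg_iff_add_eq_zero.1 h
    exact x.2 (by simp [(smul_eq_zero_iff_right two_ne_zero).1 h2])
  have hclopen : IsClopen {x : X | g x = x} := by
    refine ⟨isClosed_eq hg continuous_subtype_val, ?_⟩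
    have : {x : X | g x = x}ᶜ = {x : X | g x = -x} := by
      ext x
      exact ⟨(hgsq x).resolve_left, fun h h' => hne x (h'.symm.trans h)⟩
    rw [← isClosed_compl_iff, this]
    exact isClosed_eq hg continuous_subtype_val.neg
  let y₀ : X := ⟨-x₀, fun h => hx₀ (by simpa using L.neg_mem h)⟩
  have hgy : g y₀ = g ⟨x₀, hx₀⟩ := by simp [g, y₀]
  rcases isClopen_iff.1 hclopen with h | h
  · have h1 : g ⟨x₀, hx₀⟩ ≠ x₀ := fun h' => by
      have : (⟨x₀, hx₀⟩ : X) ∈ {x : X | g x = x} := h'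
      simp [h] at this
    have h2 : g y₀ ≠ -x₀ := fun h' => by
      have : y₀ ∈ {x : X | g x = x} := h'
      simp [h] at this
    exact h2 (hgy.trans ((hgsq _).resolve_left h1))
  · have h1 : g ⟨x₀, hx₀⟩ = x₀ := h.ge (Set.mem_univ (⟨x₀, hx₀⟩ : X))
    have h2 : g y₀ = -x₀ := h.ge (Set.mem_univ y₀)
    exact hne ⟨x₀, hx₀⟩ (h1.symm.trans (hgy.symm.trans h2))

end Hopf

/-- Hopf's theorem for bilinear maps on spaces carrying no topology. -/
theorem finrank_le_two_of_comm {V : Type*} [AddCommGroup V] [Module ℝ V] [FiniteDimensional ℝ V]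
    (m : V →ₗ[ℝ] V →ₗ[ℝ] V) (hcomm : ∀ x y, m x y = m y x)
    (hzero : ∀ x y, m x y = 0 → x = 0 ∨ y = 0) : finrank ℝ V ≤ 2 := by
  let e : EuclideanSpace ℝ (Fin (finrank ℝ V)) ≃ₗ[ℝ] V := LinearEquiv.ofFinrankEq _ _ (by simp)
  let b := (m.compl₁₂ e.toLinearMap e.toLinearMap).compr₂ e.symm.toLinearMap
  let B := (LinearMap.toContinuousLinearMap.toLinearMap ∘ₗ b).toContinuousLinearMap
  have hB : ∀ x y, B x y = e.symm (m (e x) (e y)) := fun _ _ => rfl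
  simpa using finrank_le_two_of_comm_bilin B (fun x y => by rw [hB, hB, hcomm])
    (fun x y h => by simpa using hzero (e x) (e y) (by simpa [hB] using h))

section Subalgebras

variable {A : Type*} [AddCommGroup A] [Module ℝ A] {m : A →ₗ[ℝ] A →ₗ[ℝ] A}

theorem isSubalg_genSubalg (s : Set A) : IsSubalg m (genSubalg m s) := by
  intro x hx y hy
  simp only [genSubalg, Submodule.mem_sInf] at *
  exact fun U hU => hU.1 x (hx U hU) y (hy U hU)

theorem subset_genSubalg (s : Set A) : s ⊆ genSubalg m s := by
  intro x hx
  simp only [genSubalg, SetLike.mem_coe, Submodule.mem_sInf]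
  exact fun U hU => hU.2 hx

theorem genSubalg_le {s : Set A} {U : Submodule ℝ A} (hU : IsSubalg m U) (hs : s ⊆ U) :
    genSubalg m s ≤ U :=
  sInf_le ⟨hU, hs⟩

theorem IsDivision.eq_zero_or_eq_zero (hdiv : IsDivision m) {x y : A} (h : m x y = 0) :
    x = 0 ∨ y = 0 :=
  or_iff_not_imp_left.2 fun hx => (hdiv x hx).1.1 (by simpa using h)

theorem IsSubalg.finrank_le_two_of_comm [FiniteDimensional ℝ A] (hdiv : IsDivision m)
    {U : Submodule ℝ A} (hU : IsSubalg m U) (hcomm : ∀ x ∈ U, ∀ y ∈ U, m x y = m y x) :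
    finrank ℝ U ≤ 2 := by
  let mU : U →ₗ[ℝ] U →ₗ[ℝ] U := LinearMap.mk₂ ℝ (fun x y => ⟨m x y, hU x x.2 y y.2⟩)
    (fun _ _ _ => by ext; simp) (fun _ _ _ => by ext; simp) (fun _ _ _ => by ext; simp)
    (fun _ _ _ => by ext; simp)
  refine _root_.finrank_le_two_of_comm mU (fun x y => Subtype.ext (hcomm x x.2 y y.2))
    fun x y h => ?_
  simpa using hdiv.eq_zero_or_eq_zero (congrArg Subtype.val h)

theorem isSubalg_span_self_sq [FiniteDimensional ℝ A] {U : Submodule ℝ A} (hU : IsSubalg m U)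
    (hdim : finrank ℝ U ≤ 2) {x : A} (hx : x ∈ U) :
    IsSubalg m (Submodule.span ℝ {x, m x x}) := by
  by_cases hind : LinearIndependent ℝ ![x, m x x]
  · have hle : Submodule.span ℝ {x, m x x} ≤ U := by
      simp [Submodule.span_le, Set.insert_subset_iff, hx, hU x hx x hx]
    have hfin : finrank ℝ (Submodule.span ℝ {x, m x x}) = 2 := by
      rw [← Matrix.range_cons_cons_empty x (m x x) ![], finrank_span_eq_card hind,
        Fintype.card_fin]
    rwa [Submodule.eq_of_le_of_finrank_le hle (by omega)]
  · rcases eq_or_ne x 0 with rfl | hx0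
    · intro y hy z hz
      have : y = 0 := by simpa using hy
      simp [this]
    · have hsq : ∃ c : ℝ, c • x = m x x := by
        simpa [LinearIndependent.pair_iff' hx0] using hind
      obtain ⟨c, hc⟩ := hsq
      have hspan : Submodule.span ℝ {x, m x x} = Submodule.span ℝ {x} := by
        rw [Set.pair_comm]
        exact Submodule.span_insert_eq_span (Submodule.mem_span_singleton.2 ⟨c, hc⟩)
      rw [hspan]
      intro y hy z hz
      obtain ⟨a, rfl⟩ := Submodule.mem_span_singleton.1 hy
      obtain ⟨b, rfl⟩ := Submodule.mem_span_singleton.1 hz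
      simp only [map_smul, LinearMap.smul_apply, ← hc]
      exact Submodule.smul_mem _ _ (Submodule.smul_mem _ _ (Submodule.smul_mem _ _
        (Submodule.mem_span_singleton_self x)))

end Subalgebras

/-- A finite-dimensional real division algebra is power-commutative
iff it is third-power associative and span{x, x²} is a subalgebra for every x. -/
theorem stmt_1 {A : Type*} [AddCommGroup A] [Module ℝ A] [FiniteDimensional ℝ A]
    (m : A →ₗ[ℝ] A →ₗ[ℝ] A) (hdiv : IsDivision m) :
    PowerComm m ↔
      ((∀ x : A, m x (m x x) = m (m x x) x) ∧
        ∀ x : A, IsSubalg m (Submodule.span ℝ {x, m x x})) := by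
  constructor
  · intro h
    have hmem : ∀ x, x ∈ genSubalg m {x} := fun x => subset_genSubalg {x} rfl
    refine ⟨fun x => h x x (hmem x) _ (isSubalg_genSubalg {x} x (hmem x) x (hmem x)), fun x => ?_⟩
    exact isSubalg_span_self_sq (isSubalg_genSubalg {x})
      ((isSubalg_genSubalg {x}).finrank_le_two_of_comm hdiv (h x)) (hmem x)
  · rintro ⟨h3, hsub⟩ x a ha b hb
    have hle : genSubalg m {x} ≤ Submodule.span ℝ {x, m x x} :=
      genSubalg_le (hsub x) (by
        simpa using Submodule.subset_span (R := ℝ) (Set.mem_insert x {m x x}))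
    obtain ⟨a₁, a₂, rfl⟩ := Submodule.mem_span_pair.1 (hle ha)
    obtain ⟨b₁, b₂, rfl⟩ := Submodule.mem_span_pair.1 (hle hb)
    simp only [map_add, map_smul, LinearMap.add_apply, LinearMap.smul_apply, h3 x, smul_add,
      smul_smul]
    module
end

section
/- In every third-power associative real algebra, the identity [x•y, y] = [x, y²] holds for all elements x and y, where [x,y] = xy − yx and x•y = xy + yx. -/
open Module

/-- In a third-power associative real algebra,
`[x•y, y] = [x, y²]` for all `x, y`. -/
theorem stmt_2 {A : Type*} [AddCommGroup A] [Module ℝ A]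
    (m : A →ₗ[ℝ] A →ₗ[ℝ] A)
    (h3 : ∀ x : A, m x (m x x) = m (m x x) x) :
    ∀ x y : A,
      m (m x y + m y x) y - m y (m x y + m y x) = m x (m y y) - m (m y y) x := by
  intro x y
  have hx := h3 x
  have hadd := h3 (y + x)
  have hsub := h3 (y - x)
  simp only [map_add, map_sub, LinearMap.add_apply, LinearMap.sub_apply] at hadd hsub ⊢
  linear_combination (norm := module) (-(1 / 2 : ℝ)) • hadd + (1 / 2 : ℝ) • hsub + hx
end

section
/- In a third-power associative real algebra, the centraliser C(e) of any idempotent e is invariant under left multiplication by e, and hence also under right multiplication by e. -/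
open Module

/-- In a third-power associative real algebra, the centraliser of any
idempotent `e` is invariant under left multiplication by `e`, and also under right
multiplication by `e`. -/
theorem stmt_3 {A : Type*} [AddCommGroup A] [Module ℝ A]
    (m : A →ₗ[ℝ] A →ₗ[ℝ] A)
    (h3 : ∀ x : A, m x (m x x) = m (m x x) x)
    (e : A) (he : m e e = e) :
    (∀ y ∈ centraliser m e, m e y ∈ centraliser m e) ∧
    (∀ y ∈ centraliser m e, m y e ∈ centraliser m e) := by
  have mem (y : A) : y ∈ centraliser m e ↔ m e y = m y e := by
    simp [centraliser, sub_eq_zero]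
  have left : ∀ y ∈ centraliser m e, m e y ∈ centraliser m e := by
    intro y hy
    rw [mem] at hy ⊢
    have hadd := h3 (e + y)
    have hsub := h3 (e - y)
    have hcube := h3 y
    simp only [map_add, map_sub, LinearMap.add_apply, LinearMap.sub_apply, he, ← hy]
      at hadd hsub
    -- The part of `[e + t • y, (e + t • y)²]` linear in `t` is `2 • [e, e * y]`.
    linear_combination (norm := module) (1 / 4 : ℝ) • hadd - (1 / 4 : ℝ) • hsub - (1 / 2 : ℝ) • hcube
  refine ⟨left, fun y hy => ?_⟩
  rw [← (mem y).mp hy]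
  exact left y hy
end

section
/- Let A be a finite-dimensional power-commutative real division algebra and e an omnipresent idempotent of A, with left multiplication map L_e. Then a linear subspace U ⊆ A with dim U ≥ 2 is a subalgebra of A if and only if U is a subalgebra of the isotope A_{L_e⁻¹}, whose multiplication is x ∘ y = (L_e⁻¹ x)·(L_e⁻¹ y). -/
open Module

/-- The squaring map of a commutative bilinear multiplication without zero divisors identifies
only antipodal points. -/
theorem eq_or_eq_neg_of_sq_eq_s9 {V : Type*} [AddCommGroup V] [Module ℝ V]
    (b : V →ₗ[ℝ] V →ₗ[ℝ] V) (hc : ∀ x y, b x y = b y x)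
    (hz : ∀ x y, b x y = 0 → x = 0 ∨ y = 0) {x y : V} (h : b x x = b y y) :
    x = y ∨ x = -y := by
  have : b (x - y) (x + y) = 0 := by
    simp only [map_sub, map_add, LinearMap.sub_apply, h, hc y x]; abel
  rcases hz _ _ this with h | h
  · exact .inl (sub_eq_zero.1 h)
  · exact .inr (eq_neg_of_add_eq_zero_left h)

theorem isCoveringMapOn_sq_s9 {V : Type*} [NormedAddCommGroup V] [NormedSpace ℝ V]
    [FiniteDimensional ℝ V] (b : V →ₗ[ℝ] V →ₗ[ℝ] V) (hc : ∀ x y, b x y = b y x)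
    (hz : ∀ x y, b x y = 0 → x = 0 ∨ y = 0) :
    IsCoveringMapOn (fun x => b x x) {0}ᶜ := by
  have : ProperSpace V := FiniteDimensional.proper ℝ V
  let B : V →L[ℝ] V →L[ℝ] V :=
    LinearMap.toContinuousLinearMap
      ((LinearMap.toContinuousLinearMap (𝕜 := ℝ) (E := V) (F' := V)).toLinearMap ∘ₗ b)
  have hB : ∀ x y, B x y = b x y := fun _ _ => rfl
  have hcont : Continuous fun x => b x x := by
    simp only [← hB]; fun_prop
  have hclosed : IsClosedMap fun x => b x x := by
    refine IsProperMap.isClosedMap (isProperMap_iff_tendsto_cocompact.2 ⟨hcont, ?_⟩)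
    rw [← Metric.cobounded_eq_cocompact, ← tendsto_norm_atTop_iff_cobounded]
    obtain ⟨c, hc0, hle⟩ : ∃ c > 0, ∀ x, c * (‖x‖ * ‖x‖) ≤ ‖b x x‖ := by
      obtain hV | hV := subsingleton_or_nontrivial V
      · exact ⟨1, one_pos, fun x => by simp [Subsingleton.elim x 0]⟩
      obtain ⟨u, hu, hmin⟩ := (isCompact_sphere (0 : V) 1).exists_isMinOn
        (NormedSpace.sphere_nonempty.2 zero_le_one) hcont.norm.continuousOn
      have hu1 : ‖u‖ = 1 := by simpa using hu
      refine ⟨‖b u u‖, norm_pos_iff.2 fun h => ?_, fun x => ?_⟩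
      · rcases hz _ _ h with h | h <;> simp [h] at hu1
      · obtain rfl | hx := eq_or_ne x 0
        · simp
        have hx' : ‖x‖ ≠ 0 := norm_ne_zero_iff.2 hx
        have : ‖x‖⁻¹ • x ∈ Metric.sphere (0 : V) 1 := by
          simp [norm_smul, hx']
        have h1 := isMinOn_iff.1 hmin _ this
        simp only [map_smul, LinearMap.smul_apply, norm_smul, norm_inv, norm_norm] at h1
        calc _ ≤ (‖x‖⁻¹ * (‖x‖⁻¹ * ‖b x x‖)) * (‖x‖ * ‖x‖) := by gcongr
          _ = _ := by field_simp
    refine Filter.tendsto_atTop_mono hle (Filter.Tendsto.const_mul_atTop hc0 ?_)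
    exact tendsto_norm_cobounded_atTop.atTop_mul_atTop₀ tendsto_norm_cobounded_atTop
  refine hclosed.isCoveringMapOn_of_isLocalHomeomorphOn (fun y _ => ?_) fun x hx => ?_
  · rcases (((fun x => b x x) ⁻¹' {y})).eq_empty_or_nonempty with h | ⟨x, hx⟩
    · simp [h]
    · refine (Set.toFinite {x, -x}).subset fun z hz' => ?_
      exact eq_or_eq_neg_of_sq_eq_s9 b hc hz (hz'.trans hx.symm)
  · have hx0 : x ≠ 0 := by rintro rfl; simp at hx
    have hinj : Function.Injective ((2 : ℝ) • b x) := by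
      rw [← LinearMap.ker_eq_bot, LinearMap.ker_eq_bot']
      intro z hz'
      rw [LinearMap.smul_apply, smul_eq_zero] at hz'
      exact (hz _ _ (hz'.resolve_left two_ne_zero)).resolve_left hx0
    let E : V ≃L[ℝ] V := (LinearEquiv.ofInjectiveEndo _ hinj).toContinuousLinearEquiv
    have hd : HasStrictFDerivAt (fun x => b x x) (E : V →L[ℝ] V) x := by
      have := B.hasStrictFDerivAt_of_bilinear (hasStrictFDerivAt_id x) (hasStrictFDerivAt_id x)
      refine this.congr_fderiv ?_
      ext z
      simp [E, hB, hc z x, two_smul]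
    exact ⟨_, hd.mem_toOpenPartialHomeomorph_source, by simp⟩

theorem not_linearIndependent_sq_mul_sq {V : Type*} [NormedAddCommGroup V] [NormedSpace ℝ V]
    [FiniteDimensional ℝ V] (b : V →ₗ[ℝ] V →ₗ[ℝ] V) (hc : ∀ x y, b x y = b y x)
    (hz : ∀ x y, b x y = 0 → x = 0 ∨ y = 0) (x y : V) :
    ¬ LinearIndependent ℝ ![b x x, b x y, b y y] := by
  intro hli
  have cov := isCoveringMapOn_sq_s9 b hc hz
  let f : C(ℝ × ℝ, V) := ⟨fun p => ((1 + p.1) / 2) • b x x + p.2 • b x y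
    + ((1 - p.1) / 2) • b y y, by fun_prop⟩
  have hf : ∀ p, f p ∈ ({0} : Set V)ᶜ := by
    intro p hp
    have h := Fintype.linearIndependent_iff.1 hli ![(1 + p.1) / 2, p.2, (1 - p.1) / 2]
      (by simpa [Fin.sum_univ_three, f] using hp)
    have h0 := h 0
    have h2 := h 2
    simp at h0 h2
    linarith
  have h0 : b x x = f (1, 0) := by simp [f]
  obtain ⟨F, ⟨hF0, hF⟩, -⟩ := cov.existsUnique_continuousMap_lifts f h0 hf
  let c : C(ℝ, ℝ × ℝ) := ⟨fun θ => (Real.cos (2 * θ), Real.sin (2 * θ)), by fun_prop⟩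
  let G : C(ℝ, V) := ⟨fun θ => Real.cos θ • x + Real.sin θ • y, by fun_prop⟩
  have hG : (fun x => b x x) ∘ G = f.comp c := by
    funext θ
    have h1 : (1 + Real.cos (2 * θ)) / 2 = Real.cos θ * Real.cos θ := by
      rw [Real.cos_two_mul]; ring
    have h2 : (1 - Real.cos (2 * θ)) / 2 = Real.sin θ * Real.sin θ := by
      rw [Real.cos_two_mul, Real.cos_sq']; ring
    simp only [Function.comp_apply, G, f, c, ContinuousMap.coe_mk, ContinuousMap.comp_apply,
      h1, h2, Real.sin_two_mul, map_add, map_smul, LinearMap.add_apply, LinearMap.smul_apply,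
      hc y x]
    module
  have hu := (cov.existsUnique_continuousMap_lifts (f.comp c) (a₀ := 0) (e₀ := x)
    (by simp [h0, c]) fun a => hf _).unique
    (y₁ := F.comp c) (y₂ := G) ⟨by simp [c, hF0], by
      rw [ContinuousMap.coe_comp, ContinuousMap.coe_comp, ← hF]; rfl⟩ ⟨by simp [G], hG⟩
  have hπ := DFunLike.congr_fun hu Real.pi
  have : x = -x := by simpa [c, G, hF0] using hπ
  have hx : x = 0 := by
    have h2 : (2 : ℝ) • x = 0 := by rw [two_smul]; exact eq_neg_iff_add_eq_zero.1 this
    exact (smul_eq_zero.1 h2).resolve_left two_ne_zero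
  exact hli.ne_zero 0 (by simp [hx])

theorem not_linearIndependent_one_self_sq {V : Type*} [AddCommGroup V] [Module ℝ V]
    [FiniteDimensional ℝ V] (b : V →ₗ[ℝ] V →ₗ[ℝ] V) (hc : ∀ x y, b x y = b y x)
    (hz : ∀ x y, b x y = 0 → x = 0 ∨ y = 0) {one : V} (h1 : ∀ x, b one x = x) (x : V) :
    ¬ LinearIndependent ℝ ![one, x, b x x] := by
  let φ : EuclideanSpace ℝ (Fin (finrank ℝ V)) ≃ₗ[ℝ] V := LinearEquiv.ofFinrankEq _ _ (by simp)
  have key := not_linearIndependent_sq_mul_sq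
    ((b.compl₁₂ φ.toLinearMap φ.toLinearMap).compr₂ φ.symm.toLinearMap)
    (fun x y => by simp [hc (φ x)]) (fun x y h => by simpa using hz (φ x) (φ y) (by simpa using h))
    (φ.symm one) (φ.symm x)
  contrapose! key
  have h := key.map' φ.symm.toLinearMap φ.symm.ker
  have hcomp : φ.symm.toLinearMap ∘ ![one, x, b x x]
      = ![φ.symm one, φ.symm x, φ.symm (b x x)] := by
    funext i; fin_cases i <;> rfl
  rw [hcomp] at h
  simpa [h1] using h

theorem exists_add_smul_sq_eq_neg {V : Type*} [AddCommGroup V] [Module ℝ V]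
    [FiniteDimensional ℝ V] (b : V →ₗ[ℝ] V →ₗ[ℝ] V) (hc : ∀ x y, b x y = b y x)
    (hz : ∀ x y, b x y = 0 → x = 0 ∨ y = 0) {one : V} (h1 : ∀ x, b one x = x)
    {x : V} (hx : x ∉ Submodule.span ℝ {one}) :
    ∃ r s : ℝ, s ≠ 0 ∧ b (x + r • one) (x + r • one) = -(s * s) • one := by
  have hx1 : ∀ c : ℝ, x ≠ c • one := fun c h => hx (h ▸ Submodule.smul_mem _ _
    (Submodule.mem_span_singleton_self _))
  have h0 : one ≠ 0 := by
    rintro rfl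
    exact hx1 0 (by simpa using (h1 x).symm)
  have hli : LinearIndependent ℝ ![one, x] :=
    (LinearIndependent.pair_iff' h0).2 fun c h => hx1 c h.symm
  obtain ⟨p, q, hpq⟩ : ∃ p q : ℝ, p • one + q • x = b x x := by
    have := not_linearIndependent_one_self_sq b hc hz h1 x
    by_contra hcon
    rw [← Submodule.mem_span_pair] at hcon
    refine this ?_
    have hinit : Fin.init ![one, x, b x x] = ![one, x] := by
      funext i; fin_cases i <;> rfl
    exact linearIndependent_finSucc'.2 ⟨hinit ▸ hli, by
      rw [hinit, Matrix.range_cons_cons_empty]; exact hcon⟩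
  have hsq : ∀ r : ℝ, b (x + r • one) (x + r • one) = (p + r * r) • one + (q + 2 * r) • x := by
    intro r
    simp only [map_add, map_smul, LinearMap.add_apply, LinearMap.smul_apply, h1, hc x one, ← hpq]
    module
  have hneg : p + (q / 2) * (q / 2) < 0 := by
    by_contra! h
    have := hsq (-(q / 2))
    have h2 : b (x + (-(q / 2)) • one) (x + (-(q / 2)) • one)
      = b (√(p + (q / 2) * (q / 2)) • one) (√(p + (q / 2) * (q / 2)) • one) := by
      rw [this, map_smul, map_smul, LinearMap.smul_apply, h1, smul_smul, Real.mul_self_sqrt h]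
      module
    rcases eq_or_eq_neg_of_sq_eq_s9 b hc hz h2 with h | h
    · refine hx1 (√(p + (q / 2) * (q / 2)) + q / 2) ?_
      rw [← sub_eq_zero] at h ⊢
      rw [← h]; module
    · refine hx1 (-√(p + (q / 2) * (q / 2)) + q / 2) ?_
      rw [← sub_eq_zero] at h ⊢
      rw [← h]; module
  refine ⟨-(q / 2), √(-(p + (q / 2) * (q / 2))), (Real.sqrt_pos.2 (by linarith)).ne', ?_⟩
  rw [hsq, Real.mul_self_sqrt (by linarith)]
  module

theorem finrank_le_two_of_unital {V : Type*} [AddCommGroup V] [Module ℝ V]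
    [FiniteDimensional ℝ V] (b : V →ₗ[ℝ] V →ₗ[ℝ] V) (hc : ∀ x y, b x y = b y x)
    (hz : ∀ x y, b x y = 0 → x = 0 ∨ y = 0) {one : V} (h1 : ∀ x, b one x = x) :
    finrank ℝ V ≤ 2 := by
  by_contra! hV
  have hex : ∀ W : Submodule ℝ V, finrank ℝ W ≤ 2 → ∃ x, x ∉ W := by
    intro W hW
    by_contra! h
    rw [(Submodule.eq_top_iff'.2 h), finrank_top] at hW
    omega
  have hle : finrank ℝ (Submodule.span ℝ {one}) ≤ 2 :=
    (finrank_span_le_card {one}).trans (by simp)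
  obtain ⟨y, hy⟩ := hex _ hle
  obtain ⟨z, hz'⟩ := hex (Submodule.span ℝ {one, y})
    (by rw [← Matrix.range_cons_cons_empty one y ![]]; exact finrank_range_le_card ![one, y])
  have hz1 : z ∉ Submodule.span ℝ {one} := fun h =>
    hz' (Submodule.span_mono (by simp) h)
  obtain ⟨r, s, hs, hy2⟩ := exists_add_smul_sq_eq_neg b hc hz h1 hy
  obtain ⟨r', s', hs', hz2⟩ := exists_add_smul_sq_eq_neg b hc hz h1 hz1
  have h : b (s • (z + r' • one)) (s • (z + r' • one))
      = b (s' • (y + r • one)) (s' • (y + r • one)) := by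
    simp only [map_smul, LinearMap.smul_apply, hy2, hz2]
    module
  have hno : ∀ c d : ℝ, s • z ≠ c • one + d • y := fun c d h => hz'
    ((Submodule.smul_mem_iff _ hs).1 (Submodule.mem_span_pair.2 ⟨c, d, h.symm⟩))
  rcases eq_or_eq_neg_of_sq_eq_s9 b hc hz h with h | h
  · refine hno (s' * r - s * r') s' ?_
    rw [← sub_eq_zero] at h ⊢
    rw [← h]; module
  · refine hno (-(s' * r) - s * r') (-s') ?_
    rw [← sub_eq_zero] at h ⊢
    rw [← h]; module

/-- **Hopf's theorem**: a finite-dimensional commutative real algebra without zero divisors has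
dimension at most two. -/
theorem finrank_le_two_of_commutative {V : Type*} [AddCommGroup V] [Module ℝ V]
    [FiniteDimensional ℝ V] (b : V →ₗ[ℝ] V →ₗ[ℝ] V) (hc : ∀ x y, b x y = b y x)
    (hz : ∀ x y, b x y = 0 → x = 0 ∨ y = 0) : finrank ℝ V ≤ 2 := by
  obtain hV | hV := subsingleton_or_nontrivial V
  · simp [finrank_zero_of_subsingleton]
  obtain ⟨a, ha⟩ := exists_ne (0 : V)
  have hinj : Function.Injective (b a) := by
    rw [← LinearMap.ker_eq_bot, LinearMap.ker_eq_bot']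
    exact fun z h => (hz _ _ h).resolve_left ha
  let L := LinearEquiv.ofInjectiveEndo (b a) hinj
  have hL : ∀ x, b a (L.symm x) = x := L.apply_symm_apply
  refine finrank_le_two_of_unital (b.compl₁₂ L.symm.toLinearMap L.symm.toLinearMap)
    (fun x y => hc _ _) (fun x y h => by simpa using hz _ _ h) (one := b a a) fun x => ?_
  have : L.symm (b a a) = a := L.symm_apply_apply a
  simp [this, hL]

section Omnipresent

variable {A : Type*} [AddCommGroup A] [Module ℝ A] {m : A →ₗ[ℝ] A →ₗ[ℝ] A}

theorem IsSubalg.finrank_le_two [FiniteDimensional ℝ A]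
    (hz : ∀ x y, m x y = 0 → x = 0 ∨ y = 0) {G : Submodule ℝ A} (hG : IsSubalg m G)
    (hc : ∀ a ∈ G, ∀ b ∈ G, m a b = m b a) : finrank ℝ G ≤ 2 := by
  let b : G →ₗ[ℝ] G →ₗ[ℝ] G := LinearMap.mk₂ ℝ (fun x y => ⟨m x y, hG x x.2 y y.2⟩)
    (fun _ _ _ => Subtype.ext (by simp)) (fun _ _ _ => Subtype.ext (by simp))
    (fun _ _ _ => Subtype.ext (by simp)) (fun _ _ _ => Subtype.ext (by simp))
  refine finrank_le_two_of_commutative b (fun x y => Subtype.ext (hc x x.2 y y.2)) fun x y h => ?_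
  simpa using hz x y (congrArg Subtype.val h)

theorem linearIndependent_pair_of_notMem_span {x y : A} (h : y ∉ Submodule.span ℝ {x})
    (hx : x ≠ 0) : LinearIndependent ℝ ![x, y] :=
  (LinearIndependent.pair_iff' hx).2 fun c hc => h (Submodule.mem_span_singleton.2 ⟨c, hc⟩)

theorem exists_notMem_span_singleton [FiniteDimensional ℝ A] {W : Submodule ℝ A}
    (hW : 2 ≤ finrank ℝ W) (x : A) : ∃ y ∈ W, y ∉ Submodule.span ℝ {x} := by
  by_contra! h
  have h1 := (Submodule.finrank_mono h).trans (finrank_span_le_card {x})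
  simp at h1
  omega

/-- In a plane, some element has a square that is not proportional to it. -/
theorem exists_sq_notMem_span [FiniteDimensional ℝ A]
    (hz : ∀ x y, m x y = 0 → x = 0 ∨ y = 0) {W : Submodule ℝ A} (hW : 2 ≤ finrank ℝ W) :
    ∃ u ∈ W, m u u ∉ Submodule.span ℝ {u} := by
  by_contra! h
  simp only [Submodule.mem_span_singleton] at h
  have hidem : ∀ x ∈ W, x ≠ 0 → ∃ c : ℝ, c ≠ 0 ∧ m (c • x) (c • x) = c • x := by
    intro x hx hx0
    obtain ⟨a, ha⟩ := h x hx
    have ha0 : a ≠ 0 := by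
      rintro rfl
      exact hx0 ((or_self_iff).1 (hz x x (by simpa using ha.symm)))
    refine ⟨a⁻¹, inv_ne_zero ha0, ?_⟩
    simp only [map_smul, LinearMap.smul_apply, ← ha, smul_smul]
    field_simp
  obtain ⟨x, hxW, hx⟩ := exists_notMem_span_singleton hW 0
  have hx0 : x ≠ 0 := by rintro rfl; exact hx (zero_mem _)
  obtain ⟨y, hyW, hy⟩ := exists_notMem_span_singleton hW x
  have hy0 : y ≠ 0 := by rintro rfl; exact hy (zero_mem _)
  obtain ⟨c, hc, hcx⟩ := hidem x hxW hx0
  obtain ⟨d, hd, hdy⟩ := hidem y hyW hy0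
  have hli : LinearIndependent ℝ ![c • x, d • y] := by
    refine linearIndependent_pair_of_notMem_span ?_ (smul_ne_zero hc hx0)
    rw [Submodule.smul_mem_iff _ hd]
    exact fun hmem => hy (Submodule.span_singleton_smul_le ℝ c x hmem)
  have hxW' := W.smul_mem c hxW
  have hyW' := W.smul_mem d hyW
  generalize c • x = x' at *
  generalize d • y = y' at *
  obtain ⟨p, hp⟩ := h (x' + y') (add_mem hxW' hyW')
  obtain ⟨q, hq⟩ := h (x' - y') (sub_mem hxW' hyW')
  have hsum : (p + q - 2) • x' + (p - q - 2) • y' = 0 := by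
    have hpol : m (x' + y') (x' + y') + m (x' - y') (x' - y') = (2 : ℝ) • (x' + y') := by
      simp only [map_add, map_sub, LinearMap.add_apply, LinearMap.sub_apply, hcx, hdy]
      module
    rw [← hp, ← hq, ← sub_eq_zero] at hpol
    rw [← hpol]; module
  have hcoef := LinearIndependent.pair_iff.1 hli _ _ hsum
  obtain rfl : q = 0 := by linarith [hcoef.1, hcoef.2]
  have hsub : x' - y' = 0 := (or_self_iff).1 (hz _ _ (by simpa using hq.symm))
  have := LinearIndependent.pair_iff.1 hli 1 (-1) (by rw [← hsub]; module)
  exact one_ne_zero this.1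

theorem Omnipresent.mem_genSubalg_and_finrank_eq_two [FiniteDimensional ℝ A]
    (hdiv : IsDivision m) (hpc : PowerComm m) {e : A} (he : Omnipresent m e) {u : A}
    (hu : m u u ∉ Submodule.span ℝ {u}) :
    e ∈ genSubalg m {u} ∧ finrank ℝ (genSubalg m {u}) = 2 := by
  have huG : u ∈ genSubalg m {u} := subset_genSubalg {u} rfl
  have hG := isSubalg_genSubalg (m := m) {u}
  have hfin : finrank ℝ (genSubalg m {u}) = 2 := by
    refine le_antisymm (hG.finrank_le_two (fun _ _ => hdiv.eq_zero_or_eq_zero) (hpc u)) ?_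
    have hu0 : u ≠ 0 := by rintro rfl; simp at hu
    rw [← finrank_span_pair (linearIndependent_pair_of_notMem_span hu hu0)]
    exact Submodule.finrank_mono (Submodule.span_le.2 (Set.pair_subset huG (hG u huG u huG)))
  exact ⟨he.2.2 _ hG hfin, hfin⟩

theorem Omnipresent.mem_of_isSubalg [FiniteDimensional ℝ A]
    (hdiv : IsDivision m) (hpc : PowerComm m) {e : A} (he : Omnipresent m e)
    {U : Submodule ℝ A} (hU : IsSubalg m U) (hdim : 2 ≤ finrank ℝ U) : e ∈ U := by
  obtain ⟨u, huU, hu⟩ := exists_sq_notMem_span (fun _ _ => hdiv.eq_zero_or_eq_zero) hdim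
  exact genSubalg_le hU (Set.singleton_subset_iff.2 huU)
    (he.mem_genSubalg_and_finrank_eq_two hdiv hpc hu).1

theorem Omnipresent.isSubalg_span_pair [FiniteDimensional ℝ A]
    (hdiv : IsDivision m) (hpc : PowerComm m) {e : A} (he : Omnipresent m e) (x : A) :
    IsSubalg m (Submodule.span ℝ {e, x}) := by
  by_cases hx : x ∈ Submodule.span ℝ {e}
  · have : Submodule.span ℝ {e, x} = Submodule.span ℝ {e} := by
      rw [Set.pair_comm, Submodule.span_insert_eq_span hx]
    rw [this]
    intro y hy z hz
    obtain ⟨a, rfl⟩ := Submodule.mem_span_singleton.1 hy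
    obtain ⟨b, rfl⟩ := Submodule.mem_span_singleton.1 hz
    simp only [map_smul, LinearMap.smul_apply, he.2.1]
    exact Submodule.smul_mem _ _ (Submodule.smul_mem _ _ (Submodule.mem_span_singleton_self e))
  · have hP := finrank_span_pair (linearIndependent_pair_of_notMem_span hx he.1)
    obtain ⟨u, huP, hu⟩ := exists_sq_notMem_span (fun _ _ => hdiv.eq_zero_or_eq_zero) hP.ge
    obtain ⟨heG, hG⟩ := he.mem_genSubalg_and_finrank_eq_two hdiv hpc hu
    have hue : u ∉ Submodule.span ℝ {e} := by
      intro h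
      obtain ⟨a, rfl⟩ := Submodule.mem_span_singleton.1 h
      apply hu
      simp only [map_smul, LinearMap.smul_apply, he.2.1]
      exact Submodule.smul_mem _ _ (Submodule.mem_span_singleton_self _)
    have hQ := finrank_span_pair (linearIndependent_pair_of_notMem_span hue he.1)
    have hQG : Submodule.span ℝ {e, u} = genSubalg m {u} :=
      Submodule.eq_of_le_of_finrank_eq (Submodule.span_le.2
        (Set.pair_subset heG (subset_genSubalg {u} rfl))) (hQ.trans hG.symm)
    have hQP : Submodule.span ℝ {e, u} = Submodule.span ℝ {e, x} :=
      Submodule.eq_of_le_of_finrank_eq (Submodule.span_le.2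
        (Set.pair_subset (Submodule.mem_span_pair.2 ⟨1, 0, by simp⟩) huP)) (hQ.trans hP.symm)
    rw [← hQP, hQG]
    exact isSubalg_genSubalg {u}

theorem IsSubalg.apply_inv_mem [FiniteDimensional ℝ A] {U : Submodule ℝ A} (hU : IsSubalg m U)
    {e : A} (he : e ∈ U) {S : A →ₗ[ℝ] A} (hS' : ∀ x, S (m e x) = x) {x : A} (hx : x ∈ U) :
    S x ∈ U := by
  have hinj : Function.Injective (m e) := Function.LeftInverse.injective hS'
  have hmap : U.map (m e) = U := Submodule.eq_of_le_of_finrank_eq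
    (Submodule.map_le_iff_le_comap.2 fun y hy => hU e he y hy)
    (Submodule.equivMapOfInjective (m e) hinj U).finrank_eq.symm
  rw [← hmap] at hx
  obtain ⟨w, hw, rfl⟩ := hx
  rwa [hS']

end Omnipresent

/-- For an omnipresent idempotent `e` with inverse `S` of the left
multiplication `L_e`, a subspace `U` with `dim U ≥ 2` is a subalgebra of `A` iff it is
a subalgebra of the isotope with multiplication `x ∘ y = (S x)·(S y)`. -/
theorem stmt_9 {A : Type*} [AddCommGroup A] [Module ℝ A] [FiniteDimensional ℝ A]
    (m : A →ₗ[ℝ] A →ₗ[ℝ] A) (hdiv : IsDivision m) (hpc : PowerComm m)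
    (e : A) (he : Omnipresent m e)
    (S : A →ₗ[ℝ] A) (hS : ∀ x : A, m e (S x) = x) (hS' : ∀ x : A, S (m e x) = x)
    (U : Submodule ℝ A) (hU : 2 ≤ Module.finrank ℝ U) :
    IsSubalg m U ↔ IsSubalg (isotope m S) U := by
  have hP := he.isSubalg_span_pair hdiv hpc
  have hle : e ∈ U → ∀ x ∈ U, Submodule.span ℝ {e, x} ≤ U := fun heU x hx =>
    Submodule.span_le.2 (Set.pair_subset heU hx)
  have heP : ∀ x, e ∈ Submodule.span ℝ {e, x} := fun x => Submodule.subset_span (by simp)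
  have hxP : ∀ x, x ∈ Submodule.span ℝ {e, x} := fun x => Submodule.subset_span (by simp)
  have hSP : ∀ x, S x ∈ Submodule.span ℝ {e, x} := fun x =>
    (hP x).apply_inv_mem (heP x) hS' (hxP x)
  constructor
  · intro h x hx y hy
    have heU := he.mem_of_isSubalg hdiv hpc h hU
    exact h _ (h.apply_inv_mem heU hS' hx) _ (h.apply_inv_mem heU hS' hy)
  · intro h
    have hS0 : ∀ x, S x = 0 → x = 0 := fun x hx => by rw [← hS x, hx, map_zero]
    have heU : e ∈ U := by
      obtain ⟨x, hx, hxx⟩ := exists_sq_notMem_span (m := isotope m S)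
        (fun x y hxy => (hdiv.eq_zero_or_eq_zero hxy).imp (hS0 x) (hS0 y)) hU
      obtain ⟨a, b, hab⟩ := Submodule.mem_span_pair.1 (hP x _ (hSP x) _ (hSP x))
      have ha : a ≠ 0 := by
        rintro rfl
        exact hxx (Submodule.mem_span_singleton.2 ⟨b, by simpa [isotope] using hab⟩)
      have hmem : a • e + b • x ∈ U := hab ▸ h x hx x hx
      exact (U.smul_mem_iff ha).1 ((U.add_mem_iff_left (U.smul_mem b hx)).1 hmem)
    have hLU : ∀ x ∈ U, m e x ∈ U := fun x hx => hle heU x hx (hP x _ (heP x) _ (hxP x))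
    intro x hx y hy
    have hxy : isotope m S (m e x) (m e y) = m x y := by simp [isotope, hS']
    exact hxy ▸ h _ (hLU x hx) _ (hLU y hy)
end
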